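/- arXiv:1003.5280 — 6 statements merged into one kernel-verified Lean document; each statement's English description precedes it below -/
import Mathlib

section
/- Let A be an associative unital ℂ-algebra, n ≥ 2, and σ : S_n → A^× a group homomorphism from the symmetric group into the units of A; write s_{i,j} = σ((i j)) for the images of the transpositions. Suppose e_{i,j} = e_{j,i} ∈ A (1 ≤ i ≠ j ≤ n) satisfy: e_{i,j}s_{k,l} = s_{k,l}e_{i,j} and e_{i,j}e_{k,l} = e_{k,l}e_{i,j} whenever {i,j} ∩ {k,l} = ∅; e_{i,j}e_{i,k} = s_{j,k}e_{i,k} = e_{i,j}s_{j,k} for pairwise distinct i, j, k; and s_{i,j}e_{j,k} = e_{i,k}s_{i,j} for pairwise distinct i, j, k. Then the elements X_{i,j} = s_{i,j} − e_{i,j} satisfy the Kohno integrability (infinitesimal braid) relations: [X_{i,j}, X_{k,l}] = 0 whenever {i,j} ∩ {k,l} = ∅, and [X_{i,j}, X_{i,k} + X_{j,k}] = 0 for pairwise distinct i, j, k. -/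
/-- The elements `X i j = s i j - e i j` built from the transpositions of the
symmetric group and the Brauer-algebra-type elements `e i j` satisfy the Kohno
(infinitesimal braid) integrability relations. -/
theorem brauer_infinitesimal_braid_relations
    {A : Type*} [Ring A] [Algebra ℂ A] {n : ℕ} (hn : 2 ≤ n)
    (σ : Equiv.Perm (Fin n) →* Aˣ)
    (e : Fin n → Fin n → A)
    (hsym : ∀ i j : Fin n, i ≠ j → e i j = e j i)
    (hse : ∀ i j k l : Fin n, i ≠ j → k ≠ l → ({i, j} ∩ {k, l} : Set (Fin n)) = ∅ →
      e i j * (σ (Equiv.swap k l) : A) = (σ (Equiv.swap k l) : A) * e i j)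
    (hee : ∀ i j k l : Fin n, i ≠ j → k ≠ l → ({i, j} ∩ {k, l} : Set (Fin n)) = ∅ →
      e i j * e k l = e k l * e i j)
    (heee : ∀ i j k : Fin n, i ≠ j → j ≠ k → i ≠ k →
      e i j * e i k = (σ (Equiv.swap j k) : A) * e i k ∧
      e i j * e i k = e i j * (σ (Equiv.swap j k) : A))
    (hs_e : ∀ i j k : Fin n, i ≠ j → j ≠ k → i ≠ k →
      (σ (Equiv.swap i j) : A) * e j k = e i k * (σ (Equiv.swap i j) : A)) :
    (∀ i j k l : Fin n, i ≠ j → k ≠ l → ({i, j} ∩ {k, l} : Set (Fin n)) = ∅ →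
      ((σ (Equiv.swap i j) : A) - e i j) * ((σ (Equiv.swap k l) : A) - e k l)
        - ((σ (Equiv.swap k l) : A) - e k l) * ((σ (Equiv.swap i j) : A) - e i j) = 0) ∧
    (∀ i j k : Fin n, i ≠ j → j ≠ k → i ≠ k →
      ((σ (Equiv.swap i j) : A) - e i j) *
          (((σ (Equiv.swap i k) : A) - e i k) + ((σ (Equiv.swap j k) : A) - e j k))
        - (((σ (Equiv.swap i k) : A) - e i k) + ((σ (Equiv.swap j k) : A) - e j k)) *
          ((σ (Equiv.swap i j) : A) - e i j) = 0) := by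
  have hconj : ∀ i j k : Fin n, i ≠ j → j ≠ k → i ≠ k →
      (σ (Equiv.swap i j) : A) * (σ (Equiv.swap i k) : A)
        = (σ (Equiv.swap j k) : A) * (σ (Equiv.swap i j) : A) := by
    intro i j k hij hjk hik
    rw [← Units.val_mul, ← Units.val_mul, ← map_mul, ← map_mul]
    have h := Equiv.mul_swap_eq_swap_mul (Equiv.swap i j) i k
    rw [Equiv.swap_apply_left, Equiv.swap_apply_of_ne_of_ne hik.symm hjk.symm] at h
    rw [h]
  refine ⟨?_, ?_⟩
  · intro i j k l hij hkl hd
    have hd2 : ({k, l} ∩ {i, j} : Set (Fin n)) = ∅ := by rw [Set.inter_comm]; exact hd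
    have hne : ∀ x, (x = i ∨ x = j) → (x = k ∨ x = l) → False := by
      intro x h1 h2
      have : x ∈ ({i, j} ∩ {k, l} : Set (Fin n)) := ⟨by simpa using h1, by simpa using h2⟩
      rw [hd] at this
      exact this
    have hki : k ≠ i := fun h => hne k (Or.inl h) (Or.inl rfl)
    have hkj : k ≠ j := fun h => hne k (Or.inr h) (Or.inl rfl)
    have hli : l ≠ i := fun h => hne l (Or.inl h) (Or.inr rfl)
    have hlj : l ≠ j := fun h => hne l (Or.inr h) (Or.inr rfl)
    have h1 : (σ (Equiv.swap i j) : A) * (σ (Equiv.swap k l) : A)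
        = (σ (Equiv.swap k l) : A) * (σ (Equiv.swap i j) : A) := by
      rw [← Units.val_mul, ← Units.val_mul, ← map_mul, ← map_mul]
      have h := Equiv.mul_swap_eq_swap_mul (Equiv.swap i j) k l
      rw [Equiv.swap_apply_of_ne_of_ne hki hkj, Equiv.swap_apply_of_ne_of_ne hli hlj] at h
      rw [h]
    have h2 := hse i j k l hij hkl hd
    have h3 := hse k l i j hkl hij hd2
    have h4 := hee i j k l hij hkl hd
    simp only [sub_mul, mul_sub]
    rw [h1, h2, h3, h4]
    abel
  · intro i j k hij hjk hik
    have h1 := hconj i j k hij hjk hik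
    have h2 := hconj j i k hij.symm hik hjk
    have h3 := hs_e i j k hij hjk hik
    have h4 := hs_e j i k hij.symm hik hjk
    have h5 := (heee i j k hij hjk hik).2
    have h6 := (heee j i k hij.symm hik hjk).2
    have h7 := (heee i k j hik hjk.symm hij).1
    have h8 := (heee j k i hjk hik.symm hij.symm).1
    rw [Equiv.swap_comm j i] at h2 h4
    rw [hsym j i hij.symm] at h6 h8
    rw [Equiv.swap_comm k j] at h7
    rw [Equiv.swap_comm k i] at h8
    simp only [sub_mul, mul_sub, add_mul, mul_add]
    rw [h1, h2, h3, h4, h5, h6, h7, h8]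
    abel
end

section
/- The assignment w ↦ ρ(w) for w ∈ G_m and e_i ↦ p_i for 0 ≤ i ≤ m−1 extends to a ℂ-algebra homomorphism ρ_Kr : B_{G_m}(Υ) → End(V_{G_m}). -/
noncomputable section
open scoped Classical

namespace DihOdd

open DihedralGroup

variable (m : ℕ)

/-- Generators of `B_{G_m}(Υ)`: `inl 0 = s₀`, `inl 1 = s₁`, `inr i = e_i`. -/
abbrev Gen := Fin 2 ⊕ ZMod m

/-- The generator `s₀` (for `t = 0`) or `s₁` (for `t = 1`) in the free algebra. -/
def gS (t : Fin 2) : FreeAlgebra ℂ (Gen m) := FreeAlgebra.ι ℂ (Sum.inl t)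

/-- The generator `e_i` in the free algebra. -/
def gE (i : ZMod m) : FreeAlgebra ℂ (Gen m) := FreeAlgebra.ι ℂ (Sum.inr i)

/-- The alternating word `[a, b, a, …]` of length `r`, starting with `a`. -/
def altL (a b : Fin 2) : ℕ → List (Fin 2)
  | 0 => []
  | n + 1 => a :: altL b a n

/-- Evaluation of a word in `s₀, s₁` in the free algebra. -/
def wordA (l : List (Fin 2)) : FreeAlgebra ℂ (Gen m) := (l.map (gS m)).prod

/-- Evaluation of a word in the dihedral group `G_m`: `0 ↦ s₀ = sr 0`, `1 ↦ s₁ = sr 1`. -/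
def wordG (l : List (Fin 2)) : DihedralGroup m :=
  (l.map (fun t => sr ((t : ℕ) : ZMod m))).prod

/-- The reflection `s_i = [s₁s₀⋯]_{2i−1}` as an element of the free algebra
(`s₀` itself for `i = 0`). -/
def sA (i : ZMod m) : FreeAlgebra ℂ (Gen m) :=
  if i = 0 then wordA m [0] else wordA m (altL 1 0 (2 * i.val - 1))

/-- One half mod `m` (`m` odd), used to express `k(i,j) = (i+j)/2 mod m`. -/
def half : ZMod m := (((m + 1) / 2 : ℕ) : ZMod m)

/-- The defining relations of `B_{G_m}(Υ)`, `m` odd (Definition 5.2). -/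
inductive BRel (τ : ℂ) : FreeAlgebra ℂ (Gen m) → FreeAlgebra ℂ (Gen m) → Prop
  | s0_sq : BRel τ (gS m 0 * gS m 0) 1
  | s1_sq : BRel τ (gS m 1 * gS m 1) 1
  | braid : BRel τ ((gS m 0 * gS m 1) ^ m) 1
  | se (i : ZMod m) : BRel τ (sA m i * gE m i) (gE m i)
  | es (i : ZMod m) : BRel τ (gE m i * sA m i) (gE m i)
  | move (l : List (Fin 2)) (i j : ZMod m) (h : wordG m l * sr i = sr j * wordG m l) :
      BRel τ (wordA m l * gE m i) (gE m j * wordA m l)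
  | e_sq (i : ZMod m) : BRel τ (gE m i * gE m i) (τ • gE m i)
  | ee_left (i j : ZMod m) (h : i ≠ j) :
      BRel τ (gE m i * gE m j) (sA m (half m * (i + j)) * gE m j)
  | ee_right (i j : ZMod m) (h : i ≠ j) :
      BRel τ (gE m i * gE m j) (gE m i * sA m (half m * (i + j)))

/-- The algebra `B_{G_m}(Υ)` for the dihedral group of odd type `I₂(m)`. -/
def BOdd (τ : ℂ) := RingQuot (BRel m τ)

instance (τ : ℂ) : Ring (BOdd m τ) := inferInstanceAs (Ring (RingQuot (BRel m τ)))
instance (τ : ℂ) : Algebra ℂ (BOdd m τ) := inferInstanceAs (Algebra ℂ (RingQuot (BRel m τ)))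

/-- The image in `B_{G_m}(Υ)` of a word in the generators `s₀, s₁`. -/
def wbar (τ : ℂ) (l : List (Fin 2)) : BOdd m τ :=
  RingQuot.mkAlgHom ℂ (BRel m τ) (wordA m l)

/-- The generator `e_i` of `B_{G_m}(Υ)`. -/
def ebar (τ : ℂ) (i : ZMod m) : BOdd m τ :=
  RingQuot.mkAlgHom ℂ (BRel m τ) (gE m i)

/-- The index `w(i)` defined by `w sᵢ w⁻¹ = s_{w(i)}` in the dihedral group. -/
def conjIdx (w : DihedralGroup m) (i : ZMod m) : ZMod m :=
  match w * sr i * w⁻¹ with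
  | r _ => 0
  | sr a => a

/-- The permutation representation `ρ` of `G_m` on `V_{G_m} = ℂ⟨v₀,…,v_{m−1}⟩`,
`ρ(w) v_i = v_{w(i)}`. -/
def rho (w : DihedralGroup m) : Module.End ℂ (ZMod m → ℂ) where
  toFun f := fun j => f (conjIdx m w⁻¹ j)
  map_add' _ _ := rfl
  map_smul' _ _ := rfl

variable [NeZero m]

/-- The projection `p_i`: `p_i(v_i) = τ v_i` and `p_i(v_j) = v_i` for `j ≠ i`. -/
def pEnd (τ : ℂ) (i : ZMod m) : Module.End ℂ (ZMod m → ℂ) where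
  toFun f := fun j => if j = i then (∑ j', f j') + (τ - 1) * f i else 0
  map_add' f g := by
    funext j
    by_cases h : j = i
    · simp only [h, if_pos, Pi.add_apply, Finset.sum_add_distrib]
      ring
    · simp [h]
  map_smul' c f := by
    funext j
    by_cases h : j = i
    · simp only [h, if_pos, Pi.smul_apply, smul_eq_mul, RingHom.id_apply, ← Finset.mul_sum]
      ring
    · simp [h]

end DihOdd

namespace DihOdd
open DihedralGroup

theorem sr_conjIdx (m : ℕ) (w : DihedralGroup m) (i : ZMod m) :
    sr (conjIdx m w i) = w * sr i * w⁻¹ := by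
  cases w <;> simp [conjIdx]

theorem conjIdx_eq (m : ℕ) (w : DihedralGroup m) (i j : ZMod m)
    (h : w * sr i = sr j * w) : conjIdx m w i = j := by
  have := sr_conjIdx m w i
  rw [h, mul_inv_cancel_right] at this
  exact DihedralGroup.sr.inj this

theorem conjIdx_mul (m : ℕ) (v w : DihedralGroup m) (i : ZMod m) :
    conjIdx m (v * w) i = conjIdx m v (conjIdx m w i) := by
  apply DihedralGroup.sr.inj
  rw [sr_conjIdx, sr_conjIdx, sr_conjIdx]
  group

theorem conjIdx_one (m : ℕ) (i : ZMod m) : conjIdx m 1 i = i :=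
  conjIdx_eq m _ _ _ (by simp)

def cEquiv (m : ℕ) (w : DihedralGroup m) : ZMod m ≃ ZMod m where
  toFun := conjIdx m w
  invFun := conjIdx m w⁻¹
  left_inv i := by rw [← conjIdx_mul, inv_mul_cancel, conjIdx_one]
  right_inv i := by rw [← conjIdx_mul, mul_inv_cancel, conjIdx_one]

theorem rho_one (m : ℕ) : rho m 1 = 1 := by
  ext1 f
  funext j
  simp [rho, conjIdx_one]

theorem rho_mul (m : ℕ) (v w : DihedralGroup m) : rho m (v * w) = rho m v * rho m w := by
  refine LinearMap.ext fun f => funext fun j => ?_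
  simp [rho, conjIdx_mul]

theorem rho_apply (m : ℕ) (w : DihedralGroup m) (f : ZMod m → ℂ) (j : ZMod m) :
    rho m w f j = f (conjIdx m w⁻¹ j) := rfl

theorem sum_rho (m : ℕ) [NeZero m] (w : DihedralGroup m) (f : ZMod m → ℂ) :
    ∑ j, rho m w f j = ∑ j, f j :=
  Equiv.sum_comp (cEquiv m w).symm f

theorem pEnd_apply (m : ℕ) [NeZero m] (τ : ℂ) (i : ZMod m) (f : ZMod m → ℂ) (j : ZMod m) :
    pEnd m τ i f j = if j = i then (∑ j', f j') + (τ - 1) * f i else 0 := rfl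

theorem rho_pEnd (m : ℕ) [NeZero m] (τ : ℂ) (w : DihedralGroup m) (i j : ZMod m)
    (h : conjIdx m w i = j) (f : ZMod m → ℂ) (x : ZMod m) :
    rho m w (pEnd m τ i f) x = if x = j then (∑ j', f j') + (τ - 1) * f i else 0 := by
  rw [rho_apply, pEnd_apply]
  have : conjIdx m w⁻¹ x = i ↔ x = j := by
    rw [← h]; exact (cEquiv m w).symm_apply_eq
  simp only [this]

theorem pEnd_rho (m : ℕ) [NeZero m] (τ : ℂ) (w : DihedralGroup m) (i j : ZMod m)
    (h : conjIdx m w i = j) (f : ZMod m → ℂ) (x : ZMod m) :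
    pEnd m τ j (rho m w f) x = if x = j then (∑ j', f j') + (τ - 1) * f i else 0 := by
  rw [pEnd_apply, sum_rho, rho_apply]
  have : conjIdx m w⁻¹ j = i := by
    rw [← h]; exact (cEquiv m w).symm_apply_apply i
  rw [this]

theorem pEnd_pEnd (m : ℕ) [NeZero m] (τ : ℂ) (i j : ZMod m) (hij : i ≠ j)
    (f : ZMod m → ℂ) (x : ZMod m) :
    pEnd m τ i (pEnd m τ j f) x = if x = i then (∑ j', f j') + (τ - 1) * f j else 0 := by
  simp [pEnd_apply, hij]

theorem wordG_alt (m : ℕ) (n : ℕ) :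
    wordG m (altL 1 0 (2 * n + 1)) = sr (((n + 1 : ℕ) : ZMod m)) := by
  induction n with
  | zero => simp [wordG, altL]
  | succ n ih =>
    have : wordG m (altL 1 0 (2 * (n + 1) + 1))
        = sr 1 * (sr 0 * wordG m (altL 1 0 (2 * n + 1))) := by
      simp [wordG, altL, Nat.mul_add]
    rw [this, ih]
    simp; ring

def phi0 (m : ℕ) [NeZero m] (τ : ℂ) :
    FreeAlgebra ℂ (Gen m) →ₐ[ℂ] Module.End ℂ (ZMod m → ℂ) :=
  FreeAlgebra.lift ℂ (Sum.elim (fun t : Fin 2 => rho m (sr ((t : ℕ) : ZMod m))) (pEnd m τ))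

theorem phi0_gS (m : ℕ) [NeZero m] (τ : ℂ) (t : Fin 2) :
    phi0 m τ (gS m t) = rho m (sr ((t : ℕ) : ZMod m)) := by
  simp [phi0, gS]

theorem phi0_gE (m : ℕ) [NeZero m] (τ : ℂ) (i : ZMod m) :
    phi0 m τ (gE m i) = pEnd m τ i := by
  simp [phi0, gE]

theorem phi0_wordA (m : ℕ) [NeZero m] (τ : ℂ) (l : List (Fin 2)) :
    phi0 m τ (wordA m l) = rho m (wordG m l) := by
  induction l with
  | nil => simp [wordA, wordG, rho_one]
  | cons a l ih =>
    have h1 : wordA m (a :: l) = gS m a * wordA m l := by simp [wordA]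
    have h2 : wordG m (a :: l) = sr ((a : ℕ) : ZMod m) * wordG m l := by simp [wordG]
    rw [h1, h2, map_mul, rho_mul, ih, phi0_gS]

theorem phi0_sA (m : ℕ) [NeZero m] (τ : ℂ) (i : ZMod m) :
    phi0 m τ (sA m i) = rho m (sr i) := by
  unfold sA
  split_ifs with h
  · rw [phi0_wordA, h]; simp [wordG]
  · rw [phi0_wordA]
    have hv : i.val ≠ 0 := by rwa [Ne, ZMod.val_eq_zero]
    obtain ⟨n, hn⟩ := Nat.exists_eq_succ_of_ne_zero hv
    have h2 : 2 * i.val - 1 = 2 * n + 1 := by omega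
    rw [h2, wordG_alt, ← Nat.succ_eq_add_one, ← hn, ZMod.natCast_zmod_val]

theorem conjIdx_sr (m : ℕ) (a i : ZMod m) : conjIdx m (sr a) i = 2 * a - i :=
  conjIdx_eq m _ _ _ (by simp only [sr_mul_sr]; congr 1; ring)

theorem phi0_rel (k : ℕ) (τ : ℂ) (x y : FreeAlgebra ℂ (Gen (2 * k + 1)))
    (h : BRel (2 * k + 1) τ x y) : phi0 (2 * k + 1) τ x = phi0 (2 * k + 1) τ y := by
  have hh : (2 : ZMod (2 * k + 1)) * half (2 * k + 1) = 1 := by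
    have h1 : (2 * k + 1 + 1) / 2 = k + 1 := by omega
    have h2 : ((2 * k + 1 : ℕ) : ZMod (2 * k + 1)) = 0 := ZMod.natCast_self _
    unfold half
    rw [h1]
    push_cast at h2 ⊢
    linear_combination h2
  cases h with
  | s0_sq => rw [map_mul, phi0_gS, ← rho_mul, map_one, sr_mul_self, rho_one]
  | s1_sq => rw [map_mul, phi0_gS, ← rho_mul, map_one, sr_mul_self, rho_one]
  | braid =>
    have hp : ∀ (w : DihedralGroup (2 * k + 1)) (n : ℕ),
        rho (2 * k + 1) w ^ n = rho (2 * k + 1) (w ^ n) := by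
      intro w n
      induction n with
      | zero => simp [rho_one]
      | succ n ih => rw [pow_succ, pow_succ, rho_mul, ih]
    rw [map_pow, map_mul, phi0_gS, phi0_gS, ← rho_mul, map_one, hp, ← rho_one]
    congr 1
    simp only [sr_mul_sr]
    simp
  | se i =>
    rw [map_mul, phi0_sA, phi0_gE]
    refine LinearMap.ext fun f => funext fun x => ?_
    rw [Module.End.mul_apply, rho_pEnd _ _ _ i i (by rw [conjIdx_sr]; ring), pEnd_apply]
  | es i =>
    rw [map_mul, phi0_sA, phi0_gE]
    refine LinearMap.ext fun f => funext fun x => ?_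
    rw [Module.End.mul_apply, pEnd_rho _ _ _ i i (by rw [conjIdx_sr]; ring), pEnd_apply]
  | move l i j h =>
    rw [map_mul, map_mul, phi0_wordA, phi0_gE, phi0_gE]
    have hc := conjIdx_eq _ _ _ _ h
    refine LinearMap.ext fun f => funext fun x => ?_
    rw [Module.End.mul_apply, Module.End.mul_apply, rho_pEnd _ _ _ i j hc,
      pEnd_rho _ _ _ i j hc]
  | e_sq i =>
    rw [map_mul, map_smul, phi0_gE]
    refine LinearMap.ext fun f => funext fun x => ?_
    rw [Module.End.mul_apply, LinearMap.smul_apply, Pi.smul_apply]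
    by_cases hx : x = i
    · simp [pEnd_apply, hx]; ring
    · simp [pEnd_apply, hx]
  | ee_left i j h =>
    rw [map_mul, map_mul, phi0_sA, phi0_gE, phi0_gE]
    refine LinearMap.ext fun f => funext fun x => ?_
    rw [Module.End.mul_apply, Module.End.mul_apply, pEnd_pEnd _ _ _ _ h,
      rho_pEnd _ _ _ j i (by rw [conjIdx_sr]; linear_combination (i + j) * hh)]
  | ee_right i j h =>
    rw [map_mul, map_mul, phi0_sA, phi0_gE, phi0_gE]
    refine LinearMap.ext fun f => funext fun x => ?_
    rw [Module.End.mul_apply, Module.End.mul_apply, pEnd_pEnd _ _ _ _ h,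
      pEnd_rho _ _ _ j i (by rw [conjIdx_sr]; linear_combination (i + j) * hh)]

end DihOdd

open DihOdd in
/-- for `m = 2k+1` odd, the assignment `w ↦ ρ(w)`, `e_i ↦ p_i` extends to a
`ℂ`-algebra homomorphism `ρ_Kr : B_{G_m}(Υ) → End(V_{G_m})`. -/
theorem dihedral_odd_LK_representation (k : ℕ) (hk : 1 ≤ k) (τ : ℂ) :
    ∃ φ : BOdd (2 * k + 1) τ →ₐ[ℂ] Module.End ℂ (ZMod (2 * k + 1) → ℂ),
      (∀ l : List (Fin 2),
        φ (wbar (2 * k + 1) τ l) = rho (2 * k + 1) (wordG (2 * k + 1) l)) ∧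
      (∀ i : ZMod (2 * k + 1), φ (ebar (2 * k + 1) τ i) = pEnd (2 * k + 1) τ i) := by
  let φ : RingQuot (BRel (2 * k + 1) τ) →ₐ[ℂ] Module.End ℂ (ZMod (2 * k + 1) → ℂ) :=
    RingQuot.liftAlgHom ℂ ⟨phi0 (2 * k + 1) τ, fun {x y} h => phi0_rel k τ x y h⟩
  have hφ : ∀ x, φ (RingQuot.mkAlgHom ℂ (BRel (2 * k + 1) τ) x) = phi0 (2 * k + 1) τ x :=
    fun x => RingQuot.liftAlgHom_mkAlgHom_apply ℂ _ _ x
  exact ⟨φ, fun l => (hφ _).trans (phi0_wordA _ τ l), fun i => (hφ _).trans (phi0_gE _ τ i)⟩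
end
end

section
/- (1) The assignment w ↦ ρ(w) for w ∈ G_m and e_i ↦ p_i for 0 ≤ i ≤ m−1 extends to a ℂ-algebra homomorphism Kr : B_{G_m}(Υ) → End(V_{G_m}). (2) With V⁰_{G_m} = ℂ⟨v_{2i} : 0 ≤ i ≤ l−1⟩ and V¹_{G_m} = ℂ⟨v_{2i+1} : 0 ≤ i ≤ l−1⟩, the decomposition V_{G_m} = V⁰_{G_m} ⊕ V¹_{G_m} is a direct sum of B_{G_m}(Υ)-subrepresentations; the subrepresentations are denoted Kr⁰ and Kr¹. -/
noncomputable section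
open scoped Classical

namespace DihEven

open DihedralGroup

variable (m : ℕ)

/-- Generators of `B_{G_m}(Υ)`: `inl 0 = s₀`, `inl 1 = s₁`, `inr i = e_i`. -/
abbrev Gen := Fin 2 ⊕ ZMod m

/-- The generator `s₀` (for `t = 0`) or `s₁` (for `t = 1`) in the free algebra. -/
def gS (t : Fin 2) : FreeAlgebra ℂ (Gen m) := FreeAlgebra.ι ℂ (Sum.inl t)

/-- The generator `e_i` in the free algebra. -/
def gE (i : ZMod m) : FreeAlgebra ℂ (Gen m) := FreeAlgebra.ι ℂ (Sum.inr i)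

/-- The alternating word `[a, b, a, …]` of length `r`, starting with `a`. -/
def altL (a b : Fin 2) : ℕ → List (Fin 2)
  | 0 => []
  | n + 1 => a :: altL b a n

/-- Evaluation of a word in `s₀, s₁` in the free algebra. -/
def wordA (l : List (Fin 2)) : FreeAlgebra ℂ (Gen m) := (l.map (gS m)).prod

/-- Evaluation of a word in the dihedral group `G_m`: `0 ↦ s₀ = sr 0`, `1 ↦ s₁ = sr 1`. -/
def wordG (l : List (Fin 2)) : DihedralGroup m :=
  (l.map (fun t => sr ((t : ℕ) : ZMod m))).prod

/-- The reflection `s_i = [s₁s₀⋯]_{2i−1}` as an element of the free algebra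
(`s₀` itself for `i = 0`). -/
def sA (i : ZMod m) : FreeAlgebra ℂ (Gen m) :=
  if i = 0 then wordA m [0] else wordA m (altL 1 0 (2 * i.val - 1))

/-- The parameter `μ_a`, depending only on the parity of `a`. -/
def muP (μ0 μ1 : ℂ) (a : ZMod m) : ℂ := if a.val % 2 = 0 then μ0 else μ1

/-- The parameter `τ_a`, depending only on the parity of `a`. -/
def tauP (τ0 τ1 : ℂ) (a : ZMod m) : ℂ := if a.val % 2 = 0 then τ0 else τ1

/-- A half of `x` in `ZMod m` (used for indices `[(i+j)/2]`, with `i+j` even). -/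
def hf (x : ZMod m) : ZMod m := ((x.val / 2 : ℕ) : ZMod m)

/-- `l = m/2` as an element of `ZMod m`. -/
def lZ : ZMod m := ((m / 2 : ℕ) : ZMod m)

/-- The defining relations of `B_{G_m}(Υ)`, `m = 2l` even (Definition 5.3). -/
inductive BRel (μ0 μ1 τ0 τ1 : ℂ) :
    FreeAlgebra ℂ (Gen m) → FreeAlgebra ℂ (Gen m) → Prop
  | s0_sq : BRel μ0 μ1 τ0 τ1 (gS m 0 * gS m 0) 1
  | s1_sq : BRel μ0 μ1 τ0 τ1 (gS m 1 * gS m 1) 1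
  | braid : BRel μ0 μ1 τ0 τ1 ((gS m 0 * gS m 1) ^ m) 1
  | se (i : ZMod m) : BRel μ0 μ1 τ0 τ1 (sA m i * gE m i) (gE m i)
  | es (i : ZMod m) : BRel μ0 μ1 τ0 τ1 (gE m i * sA m i) (gE m i)
  | move (l : List (Fin 2)) (i j : ZMod m) (h : wordG m l * sr i = sr j * wordG m l) :
      BRel μ0 μ1 τ0 τ1 (wordA m l * gE m i) (gE m j * wordA m l)
  | e_sq (i : ZMod m) :
      BRel μ0 μ1 τ0 τ1 (gE m i * gE m i) (tauP m τ0 τ1 i • gE m i)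
  | e_odd (i j : ZMod m) (h : i.val % 2 ≠ j.val % 2) :
      BRel μ0 μ1 τ0 τ1 (gE m i * gE m j) 0
  | e_even (i j c : ZMod m) (hij : i ≠ j) (hpar : i.val % 2 = j.val % 2)
      (hc : c + c = i + j) :
      BRel μ0 μ1 τ0 τ1 (gE m i * gE m j)
        ((muP m μ0 μ1 c • sA m c + muP m μ0 μ1 (c + lZ m) • sA m (c + lZ m)) * gE m j)

/-- The algebra `B_{G_m}(Υ)` for the dihedral group of even type `I₂(m)`, `m = 2l`. -/
def BEven (μ0 μ1 τ0 τ1 : ℂ) := RingQuot (BRel m μ0 μ1 τ0 τ1)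

instance (μ0 μ1 τ0 τ1 : ℂ) : Ring (BEven m μ0 μ1 τ0 τ1) :=
  inferInstanceAs (Ring (RingQuot (BRel m μ0 μ1 τ0 τ1)))
instance (μ0 μ1 τ0 τ1 : ℂ) : Algebra ℂ (BEven m μ0 μ1 τ0 τ1) :=
  inferInstanceAs (Algebra ℂ (RingQuot (BRel m μ0 μ1 τ0 τ1)))

/-- The image in `B_{G_m}(Υ)` of a word in the generators `s₀, s₁`. -/
def wbar (μ0 μ1 τ0 τ1 : ℂ) (l : List (Fin 2)) : BEven m μ0 μ1 τ0 τ1 :=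
  RingQuot.mkAlgHom ℂ (BRel m μ0 μ1 τ0 τ1) (wordA m l)

/-- The generator `e_i` of `B_{G_m}(Υ)`. -/
def ebar (μ0 μ1 τ0 τ1 : ℂ) (i : ZMod m) : BEven m μ0 μ1 τ0 τ1 :=
  RingQuot.mkAlgHom ℂ (BRel m μ0 μ1 τ0 τ1) (gE m i)

/-- The index `w(i)` defined by `w sᵢ w⁻¹ = s_{w(i)}` in the dihedral group. -/
def conjIdx (w : DihedralGroup m) (i : ZMod m) : ZMod m :=
  match w * sr i * w⁻¹ with
  | r _ => 0
  | sr a => a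

/-- The permutation representation `ρ` of `G_m` on `V_{G_m} = ℂ⟨v₀,…,v_{m−1}⟩`,
`ρ(w) v_i = v_{w(i)}`. -/
def rho (w : DihedralGroup m) : Module.End ℂ (ZMod m → ℂ) where
  toFun f := fun j => f (conjIdx m w⁻¹ j)
  map_add' _ _ := rfl
  map_smul' _ _ := rfl

/-- The matrix coefficient of `p_i` in the `V`-picture: the coefficient of `f j` in
`(p_i f) i`. -/
def coefV (μ0 μ1 τ0 τ1 : ℂ) (i j : ZMod m) : ℂ :=
  if j = i then tauP m τ0 τ1 i
  else if j.val % 2 = i.val % 2 then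
    muP m μ0 μ1 (hf m (i + j)) + muP m μ0 μ1 (hf m (i + j) + lZ m)
  else 0

variable [NeZero m]

/-- The projection `p_i` of the generalized Lawrence–Krammer representation on
`V_{G_m}`. -/
def pV (μ0 μ1 τ0 τ1 : ℂ) (i : ZMod m) : Module.End ℂ (ZMod m → ℂ) where
  toFun f := fun t => if t = i then ∑ j', coefV m μ0 μ1 τ0 τ1 i j' * f j' else 0
  map_add' f g := by
    funext t
    by_cases h : t = i
    · simp only [h, if_pos, Pi.add_apply, mul_add, Finset.sum_add_distrib]
    · simp [h]
  map_smul' c f := by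
    funext t
    by_cases h : t = i
    · simp only [h, if_pos, Pi.smul_apply, smul_eq_mul, RingHom.id_apply, Finset.mul_sum]
      exact Finset.sum_congr rfl fun j' _ => by ring
    · simp [h]

/-- The subspace of `V_{G_m}` (or `W_{G_m}`) spanned by the basis vectors with index of
parity `r`. -/
def paritySub (r : ℕ) : Submodule ℂ (ZMod m → ℂ) where
  carrier := {f | ∀ j : ZMod m, j.val % 2 ≠ r → f j = 0}
  add_mem' hf hg j hj := by simp [hf j hj, hg j hj]
  zero_mem' j _ := rfl
  smul_mem' c f hf j hj := by simp [hf j hj]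

/-- The matrix `M⁰` (for `r = 0`) or `M¹` (for `r = 1`) of the projections `p_i`
restricted to the even/odd-indexed basis vectors of `V_{G_m}`; `m = 2l`. -/
def MV (lv : ℕ) (μ0 μ1 τ0 τ1 : ℂ) (r : ℕ) : Matrix (Fin lv) (Fin lv) ℂ :=
  fun i j => coefV m μ0 μ1 τ0 τ1 ((2 * (i : ℕ) + r : ℕ) : ZMod m)
    ((2 * (j : ℕ) + r : ℕ) : ZMod m)

/-- The operator `s̄_i` on `W_{G_m}` defined by `s̄_i(w_j) = ε^i_{j,r} w_r`. -/
def sbarW (ε : ZMod m → ZMod m → ℝ) (rIdx : ZMod m → ZMod m → ZMod m) (i : ZMod m) :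
    Module.End ℂ (ZMod m → ℂ) where
  toFun f := fun t => ∑ j', (if rIdx i j' = t then (ε i j' : ℂ) else 0) * f j'
  map_add' f g := by
    funext t
    simp only [Pi.add_apply, mul_add, Finset.sum_add_distrib]
  map_smul' c f := by
    funext t
    simp only [Pi.smul_apply, smul_eq_mul, RingHom.id_apply, Finset.mul_sum]
    exact Finset.sum_congr rfl fun j' _ => by ring

/-- The matrix coefficient of `p_i` in the `W`-picture. -/
def coefW (μ0 μ1 : ℂ) (ε : ZMod m → ZMod m → ℝ) (i j : ZMod m) : ℂ :=
  if j.val % 2 = i.val % 2 then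
    muP m μ0 μ1 (hf m (i + j)) * (ε (hf m (i + j)) j : ℂ)
      + muP m μ0 μ1 (hf m (i + j) + lZ m) * (ε (hf m (i + j) + lZ m) j : ℂ)
  else 0

/-- The projection `p_i` in the `W`-picture. -/
def pW (μ0 μ1 : ℂ) (ε : ZMod m → ZMod m → ℝ) (i : ZMod m) :
    Module.End ℂ (ZMod m → ℂ) where
  toFun f := fun t => if t = i then ∑ j', coefW m μ0 μ1 ε i j' * f j' else 0
  map_add' f g := by
    funext t
    by_cases h : t = i
    · simp only [h, if_pos, Pi.add_apply, mul_add, Finset.sum_add_distrib]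
    · simp [h]
  map_smul' c f := by
    funext t
    by_cases h : t = i
    · simp only [h, if_pos, Pi.smul_apply, smul_eq_mul, RingHom.id_apply, Finset.mul_sum]
      exact Finset.sum_congr rfl fun j' _ => by ring
    · simp [h]

/-- The matrix `A⁰` (for `r = 0`) or `A¹` (for `r = 1`) of the projections `p_i` in the
`W`-picture restricted to the even/odd-indexed basis vectors; `m = 2l`. -/
def AW (lv : ℕ) (μ0 μ1 : ℂ) (ε : ZMod m → ZMod m → ℝ) (r : ℕ) :
    Matrix (Fin lv) (Fin lv) ℂ :=
  fun i j => coefW m μ0 μ1 ε ((2 * (i : ℕ) + r : ℕ) : ZMod m)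
    ((2 * (j : ℕ) + r : ℕ) : ZMod m)

end DihEven

namespace DihEven
open DihedralGroup

section aux
variable {lv : ℕ} [NeZero (2 * lv)]

def P (lv : ℕ) : ZMod (2 * lv) →+* ZMod 2 := ZMod.castHom (Dvd.intro lv rfl) (ZMod 2)

lemma val_P (x : ZMod (2 * lv)) : x.val % 2 = (P lv x).val := by
  conv_rhs => rw [← ZMod.natCast_zmod_val x]
  rw [map_natCast, ZMod.val_natCast]

lemma par_iff (x y : ZMod (2 * lv)) : x.val % 2 = y.val % 2 ↔ P lv x = P lv y := by
  rw [val_P, val_P]; exact (ZMod.val_injective 2).eq_iff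

lemma P_two (x : ZMod (2 * lv)) : P lv x + P lv x = 0 := CharTwo.add_self_eq_zero _

lemma muP_congr (a b : ℂ) {x y : ZMod (2 * lv)} (h : P lv x = P lv y) :
    muP (2 * lv) a b x = muP (2 * lv) a b y := by
  unfold muP; rw [(par_iff x y).2 h]

lemma tauP_congr (a b : ℂ) {x y : ZMod (2 * lv)} (h : P lv x = P lv y) :
    tauP (2 * lv) a b x = tauP (2 * lv) a b y := by
  unfold tauP; rw [(par_iff x y).2 h]

lemma lZ_add : lZ (2 * lv) + lZ (2 * lv) = 0 := by
  unfold lZ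
  rw [← Nat.cast_add, ZMod.natCast_eq_zero_iff]
  have : 2 * lv / 2 + 2 * lv / 2 = 2 * lv := by omega
  rw [this]

lemma dbl_zero {x : ZMod (2 * lv)} (h : x + x = 0) : x = 0 ∨ x = lZ (2 * lv) := by
  have hx := ZMod.natCast_zmod_val x
  have hlt := ZMod.val_lt x
  rw [← hx, ← Nat.cast_add, ZMod.natCast_eq_zero_iff] at h
  obtain ⟨k, hk⟩ := h
  have hk' : x.val = lv * k := by nlinarith
  have : k < 2 := by
    by_contra hc
    have : lv * 2 ≤ lv * k := Nat.mul_le_mul_left _ (by omega)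
    omega
  interval_cases k
  · left; rw [← hx, hk']; simp
  · right; rw [← hx, hk']; unfold lZ; simp

lemma hf_dbl {x : ZMod (2 * lv)} (h : P lv x = 0) : hf (2 * lv) x + hf (2 * lv) x = x := by
  unfold hf
  have : x.val % 2 = 0 := by rw [val_P, h]; rfl
  rw [← Nat.cast_add, show x.val / 2 + x.val / 2 = x.val by omega, ZMod.natCast_zmod_val]

def MM (lv : ℕ) (a b : ℂ) (c : ZMod (2 * lv)) : ℂ :=
  muP (2 * lv) a b c + muP (2 * lv) a b (c + lZ (2 * lv))

lemma MM_congr (a b : ℂ) {c d : ZMod (2 * lv)} (h : P lv c = P lv d) :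
    MM lv a b c = MM lv a b d := by
  unfold MM
  rw [muP_congr a b h, muP_congr a b (show P lv (c + lZ _) = P lv (d + lZ _) by simp [h])]

lemma MM_dbl (a b : ℂ) {c d : ZMod (2 * lv)} (h : c + c = d + d) :
    MM lv a b c = MM lv a b d := by
  have : (c - d) + (c - d) = 0 := by linear_combination h
  rcases dbl_zero this with h | h
  · rw [sub_eq_zero.1 h]
  · have : c = d + lZ _ := by linear_combination h
    subst this
    unfold MM
    rw [add_assoc, lZ_add, add_zero, add_comm]

lemma P_add_dbl {i j c : ZMod (2 * lv)} (h : c + c = i + j) : P lv i = P lv j := by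
  have h1 := congrArg (P lv) h
  rw [map_add, map_add, P_two] at h1
  exact CharTwo.add_eq_zero.1 h1.symm

lemma coefV_self (a b c d : ℂ) (i : ZMod (2 * lv)) :
    coefV (2 * lv) a b c d i i = tauP (2 * lv) c d i := by simp [coefV]

lemma coefV_odd (a b c d : ℂ) {i j : ZMod (2 * lv)} (h : P lv i ≠ P lv j) :
    coefV (2 * lv) a b c d i j = 0 := by
  unfold coefV
  rw [if_neg, if_neg]
  · rw [par_iff]; exact fun e => h e.symm
  · rintro rfl; exact h rfl

lemma coefV_even (a b c d : ℂ) {i j k : ZMod (2 * lv)} (hij : i ≠ j) (h : k + k = i + j) :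
    coefV (2 * lv) a b c d i j = MM lv a b k := by
  have hP := P_add_dbl h
  unfold coefV
  rw [if_neg hij.symm, if_pos ((par_iff _ _).2 hP.symm)]
  apply MM_dbl a b
  rw [h]
  exact hf_dbl (by rw [map_add, hP, P_two])

lemma conj_r (m : ℕ) (a i : ZMod m) : conjIdx m (r a) i = i - a - a := by
  simp [conjIdx, sub_eq_add_neg]

lemma conj_sr (m : ℕ) (a i : ZMod m) : conjIdx m (sr a) i = a + a - i := by
  simp only [conjIdx, inv_sr, sr_mul_sr, r_mul_sr]; ring

lemma conj_mul (m : ℕ) (v w : DihedralGroup m) (i : ZMod m) :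
    conjIdx m (v * w) i = conjIdx m v (conjIdx m w i) := by
  rcases v with a | a <;> rcases w with b | b <;>
    simp only [r_mul_r, r_mul_sr, sr_mul_r, sr_mul_sr, conj_r, conj_sr] <;> ring

lemma conj_one (m : ℕ) (i : ZMod m) : conjIdx m 1 i = i := by
  rw [one_def, conj_r]; ring

lemma P_conj (w : DihedralGroup (2 * lv)) (i : ZMod (2 * lv)) :
    P lv (conjIdx (2 * lv) w i) = P lv i := by
  rcases w with a | a
  · rw [conj_r, sub_sub, map_sub, map_add, P_two, sub_zero]
  · rw [conj_sr, map_sub, map_add, P_two, zero_sub, CharTwo.neg_eq]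

lemma conj_inj (m : ℕ) (w : DihedralGroup m) : Function.Injective (conjIdx m w) := by
  intro i j h
  have := congrArg (conjIdx m w⁻¹) h
  simpa [← conj_mul, conj_one] using this

lemma coefV_conj (a b c d : ℂ) (w : DihedralGroup (2 * lv)) (i j : ZMod (2 * lv)) :
    coefV (2 * lv) a b c d (conjIdx _ w i) (conjIdx _ w j) = coefV (2 * lv) a b c d i j := by
  by_cases hij : i = j
  · subst hij
    rw [coefV_self, coefV_self]
    exact tauP_congr _ _ (P_conj w i)
  by_cases hP : P lv i = P lv j
  · have hk : hf (2 * lv) (i + j) + hf (2 * lv) (i + j) = i + j :=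
      hf_dbl (by rw [map_add, hP, P_two])
    set k := hf (2 * lv) (i + j)
    rw [coefV_even a b c d hij hk]
    have hij' : conjIdx _ w i ≠ conjIdx _ w j := fun h => hij (conj_inj _ w h)
    rw [coefV_even a b c d hij' (k := conjIdx _ w k)]
    · exact MM_congr a b (P_conj w k)
    · rcases w with x | x
      · simp only [conj_r]; linear_combination hk
      · simp only [conj_sr]; linear_combination -hk
  · rw [coefV_odd _ _ _ _ hP, coefV_odd]
    rwa [P_conj, P_conj]

lemma rho_apply (m : ℕ) (w : DihedralGroup m) (f : ZMod m → ℂ) (j : ZMod m) :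
    rho m w f j = f (conjIdx m w⁻¹ j) := rfl

lemma rho_mul (m : ℕ) (v w : DihedralGroup m) : rho m (v * w) = rho m v * rho m w := by
  refine LinearMap.ext fun f => funext fun j => ?_
  rw [Module.End.mul_apply, rho_apply, rho_apply, rho_apply, mul_inv_rev, conj_mul]

lemma rho_one (m : ℕ) : rho m 1 = 1 := by
  refine LinearMap.ext fun f => funext fun j => ?_
  rw [rho_apply, inv_one, conj_one]; rfl

lemma pV_apply (m : ℕ) [NeZero m] (a b c d : ℂ) (i : ZMod m) (f : ZMod m → ℂ) (t : ZMod m) :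
    pV m a b c d i f t = if t = i then ∑ j', coefV m a b c d i j' * f j' else 0 := rfl

lemma move_rel (a b c d : ℂ) (w : DihedralGroup (2 * lv)) (i : ZMod (2 * lv)) :
    rho _ w * pV (2 * lv) a b c d i = pV (2 * lv) a b c d (conjIdx _ w i) * rho _ w := by
  refine LinearMap.ext fun f => funext fun t => ?_
  rw [Module.End.mul_apply, Module.End.mul_apply, rho_apply, pV_apply, pV_apply]
  have hiff : conjIdx _ w⁻¹ t = i ↔ t = conjIdx _ w i := by
    constructor
    · rintro rfl; simp [← conj_mul, conj_one]
    · rintro rfl; simp [← conj_mul, conj_one]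
  simp only [hiff]
  split_ifs
  · have hb : Function.Bijective (conjIdx (2 * lv) w) :=
      Finite.injective_iff_bijective.1 (conj_inj _ w)
    refine Fintype.sum_bijective _ hb _ _ fun j => ?_
    rw [coefV_conj, rho_apply, ← conj_mul, inv_mul_cancel, conj_one]
  · rfl

lemma pV_mul (a b c d : ℂ) (i j : ZMod (2 * lv)) (f : ZMod (2 * lv) → ℂ) (t : ZMod (2 * lv)) :
    pV (2 * lv) a b c d i (pV (2 * lv) a b c d j f) t =
      if t = i then coefV (2 * lv) a b c d i j * ∑ j', coefV (2 * lv) a b c d j j' * f j'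
      else 0 := by
  rw [pV_apply]
  congr 1
  rw [Finset.sum_eq_single j]
  · rw [pV_apply, if_pos rfl]
  · intro k _ hk; rw [pV_apply, if_neg hk, mul_zero]
  · simp

lemma se_rel (a b c d : ℂ) (i : ZMod (2 * lv)) :
    rho _ (sr i) * pV (2 * lv) a b c d i = pV (2 * lv) a b c d i := by
  refine LinearMap.ext fun f => funext fun t => ?_
  rw [Module.End.mul_apply, rho_apply, pV_apply, pV_apply, inv_sr, conj_sr]
  congr 1
  rw [eq_iff_iff]
  constructor <;> intro h <;> linear_combination -h

lemma es_rel (a b c d : ℂ) (i : ZMod (2 * lv)) :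
    pV (2 * lv) a b c d i * rho _ (sr i) = pV (2 * lv) a b c d i := by
  have := move_rel a b c d (sr i) i
  rw [se_rel, conj_sr, add_sub_cancel_right] at this
  exact this.symm

/-- the assignment on generators -/
def genMap (lv : ℕ) [NeZero (2 * lv)] (a b c d : ℂ) :
    FreeAlgebra ℂ (Gen (2 * lv)) →ₐ[ℂ] Module.End ℂ (ZMod (2 * lv) → ℂ) :=
  FreeAlgebra.lift ℂ (Sum.elim (fun t : Fin 2 => rho (2 * lv) (sr ((t : ℕ) : ZMod (2 * lv))))
    (pV (2 * lv) a b c d))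

lemma gen_S (a b c d : ℂ) (t : Fin 2) :
    genMap lv a b c d (gS _ t) = rho (2 * lv) (sr ((t : ℕ) : ZMod (2 * lv))) := by
  simp [genMap, gS]

lemma gen_E (a b c d : ℂ) (i : ZMod (2 * lv)) :
    genMap lv a b c d (gE _ i) = pV (2 * lv) a b c d i := by
  simp [genMap, gE]

lemma gen_word (a b c d : ℂ) (l : List (Fin 2)) :
    genMap lv a b c d (wordA _ l) = rho (2 * lv) (wordG _ l) := by
  induction l with
  | nil => simp [wordA, wordG, rho_one]
  | cons t l ih =>
    have h1 : wordA (2 * lv) (t :: l) = gS _ t * wordA _ l := by simp [wordA]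
    have h2 : wordG (2 * lv) (t :: l) = sr ((t : ℕ) : ZMod (2 * lv)) * wordG _ l := by
      simp [wordG]
    rw [h1, h2, map_mul, ih, gen_S, rho_mul]

lemma wordG_alt (m n : ℕ) : wordG m (altL 1 0 (2 * n + 1)) = sr ((n : ZMod m) + 1) := by
  induction n with
  | zero => simp [altL, wordG]
  | succ n ih =>
    have h2 : wordG m (altL 1 0 (2 * (n + 1) + 1))
        = sr 1 * (sr 0 * wordG m (altL 1 0 (2 * n + 1))) := by
      rw [show 2 * (n + 1) + 1 = (2 * n + 1) + 1 + 1 by ring, altL, altL]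
      simp [wordG]
    rw [h2, ih, sr_mul_sr, sr_mul_r]
    push_cast
    congr 1; ring

lemma gen_sA (a b c d : ℂ) (i : ZMod (2 * lv)) :
    genMap lv a b c d (sA _ i) = rho (2 * lv) (sr i) := by
  unfold sA
  split_ifs with h
  · subst h; rw [gen_word]; simp [wordG]
  · rw [gen_word]
    have : i.val ≠ 0 := by rwa [Ne, ZMod.val_eq_zero]
    obtain ⟨n, hn⟩ := Nat.exists_eq_succ_of_ne_zero this
    rw [show 2 * i.val - 1 = 2 * n + 1 by omega, wordG_alt]
    congr 2
    rw [← ZMod.natCast_zmod_val i, hn]; push_cast; rfl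

lemma gen_rel (a b c d : ℂ) {x y : FreeAlgebra ℂ (Gen (2 * lv))}
    (h : BRel (2 * lv) a b c d x y) : genMap lv a b c d x = genMap lv a b c d y := by
  cases h with
  | s0_sq => rw [map_mul, gen_S, ← rho_mul, sr_mul_self, rho_one, map_one]
  | s1_sq => rw [map_mul, gen_S, ← rho_mul, sr_mul_self, rho_one, map_one]
  | braid =>
    rw [map_pow, map_mul, gen_S, gen_S, ← rho_mul, map_one]
    have : ∀ (w : DihedralGroup (2 * lv)) (n : ℕ), rho _ w ^ n = rho _ (w ^ n) := by
      intro w n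
      induction n with
      | zero => simp [rho_one]
      | succ n ih => rw [pow_succ, pow_succ, rho_mul, ih]
    rw [this, ← rho_one]
    congr 1
    rw [sr_mul_sr]
    simp
  | se i => rw [map_mul, gen_sA, gen_E, se_rel]
  | es i => rw [map_mul, gen_sA, gen_E, es_rel]
  | move l i j h =>
    rw [map_mul, map_mul, gen_word, gen_E, gen_E, move_rel]
    have : conjIdx _ (wordG (2 * lv) l) i = j := by
      unfold conjIdx; rw [h, mul_inv_cancel_right]
    rw [this]
  | e_sq i =>
    rw [map_mul, map_smul, gen_E]
    refine LinearMap.ext fun f => funext fun t => ?_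
    rw [Module.End.mul_apply, pV_mul, coefV_self, LinearMap.smul_apply, Pi.smul_apply, pV_apply]
    simp
  | e_odd i j h =>
    rw [map_mul, map_zero, gen_E, gen_E]
    refine LinearMap.ext fun f => funext fun t => ?_
    rw [Module.End.mul_apply, pV_mul, coefV_odd]
    · simp
    · rwa [Ne, ← par_iff]
  | e_even i j k hij hpar hk =>
    rw [map_mul, map_mul, map_add, map_smul, map_smul, gen_sA, gen_sA, gen_E, gen_E]
    refine LinearMap.ext fun f => funext fun t => ?_
    rw [Module.End.mul_apply, pV_mul, coefV_even a b c d hij hk, Module.End.mul_apply,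
      LinearMap.add_apply, LinearMap.smul_apply, LinearMap.smul_apply, Pi.add_apply,
      Pi.smul_apply, Pi.smul_apply, rho_apply, rho_apply, inv_sr, inv_sr, conj_sr, conj_sr,
      pV_apply, pV_apply]
    have e1 : (k + k - t = j) ↔ t = i := by
      rw [hk]; constructor <;> intro h <;> linear_combination -h
    have e2 : k + lZ (2 * lv) + (k + lZ (2 * lv)) - t = k + k - t := by
      linear_combination (lZ_add (lv := lv))
    rw [e2]
    simp only [e1]
    split_ifs
    · unfold MM; simp only [smul_eq_mul]; ring
    · simp

lemma rho_par (w : DihedralGroup (2 * lv)) (n : ℕ) (f : ZMod (2 * lv) → ℂ)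
    (h : f ∈ paritySub (2 * lv) n) : rho _ w f ∈ paritySub (2 * lv) n := by
  intro j hj
  rw [rho_apply]
  apply h
  rwa [(par_iff _ j).2 (P_conj _ _)]

lemma pV_par (a b c d : ℂ) (i : ZMod (2 * lv)) (n : ℕ) (f : ZMod (2 * lv) → ℂ)
    (h : f ∈ paritySub (2 * lv) n) : pV (2 * lv) a b c d i f ∈ paritySub (2 * lv) n := by
  intro t ht
  rw [pV_apply]
  split_ifs with hti
  · subst hti
    refine Finset.sum_eq_zero fun j _ => ?_
    by_cases hP : P lv t = P lv j
    · rw [h j (by rwa [← (par_iff _ _).2 hP]), mul_zero]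
    · rw [coefV_odd _ _ _ _ hP, zero_mul]
  · rfl

lemma par_compl (m : ℕ) [NeZero m] : IsCompl (paritySub m 0) (paritySub m 1) := by
  constructor
  · rw [Submodule.disjoint_def]
    intro f h0 h1
    funext j
    by_cases h : j.val % 2 = 0
    · exact h1 j (by omega)
    · exact h0 j h
  · rw [codisjoint_iff, Submodule.eq_top_iff']
    intro f
    rw [Submodule.mem_sup]
    refine ⟨fun j => if j.val % 2 = 0 then f j else 0, ?_,
      fun j => if j.val % 2 = 0 then 0 else f j, ?_, ?_⟩
    · intro j hj; exact if_neg hj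
    · intro j hj; exact if_pos (by omega)
    · funext j; simp only [Pi.add_apply]; split_ifs <;> simp

end aux
end DihEven

open DihEven in
/-- for `m = 2l` even, (1) the assignment `w ↦ ρ(w)`, `e_i ↦ p_i` extends to
a `ℂ`-algebra homomorphism `Kr : B_{G_m}(Υ) → End(V_{G_m})`, and (2) the even/odd
coordinate subspaces `V⁰, V¹` give a direct sum decomposition of `V_{G_m}` into
`B_{G_m}(Υ)`-subrepresentations. -/
theorem dihedral_even_LK_representation (lv : ℕ) (hl : 2 ≤ lv) [NeZero (2 * lv)]
    (μ0 μ1 τ0 τ1 : ℂ) :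
    (∃ φ : BEven (2 * lv) μ0 μ1 τ0 τ1 →ₐ[ℂ] Module.End ℂ (ZMod (2 * lv) → ℂ),
      (∀ l : List (Fin 2),
        φ (wbar (2 * lv) μ0 μ1 τ0 τ1 l) = rho (2 * lv) (wordG (2 * lv) l)) ∧
      (∀ i : ZMod (2 * lv),
        φ (ebar (2 * lv) μ0 μ1 τ0 τ1 i) = pV (2 * lv) μ0 μ1 τ0 τ1 i)) ∧
    IsCompl (paritySub (2 * lv) 0) (paritySub (2 * lv) 1) ∧
    (∀ φ : BEven (2 * lv) μ0 μ1 τ0 τ1 →ₐ[ℂ] Module.End ℂ (ZMod (2 * lv) → ℂ),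
      (∀ l : List (Fin 2),
        φ (wbar (2 * lv) μ0 μ1 τ0 τ1 l) = rho (2 * lv) (wordG (2 * lv) l)) →
      (∀ i : ZMod (2 * lv),
        φ (ebar (2 * lv) μ0 μ1 τ0 τ1 i) = pV (2 * lv) μ0 μ1 τ0 τ1 i) →
      ∀ r : Fin 2, ∀ (a : BEven (2 * lv) μ0 μ1 τ0 τ1) (f : ZMod (2 * lv) → ℂ),
        f ∈ paritySub (2 * lv) (r : ℕ) → φ a f ∈ paritySub (2 * lv) (r : ℕ)) := by
  refine ⟨⟨RingQuot.liftAlgHom ℂ ⟨genMap lv μ0 μ1 τ0 τ1, fun _ _ h => gen_rel _ _ _ _ h⟩,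
    fun l => ?_, fun i => ?_⟩, par_compl _, ?_⟩
  · exact (RingQuot.liftAlgHom_mkAlgHom_apply _ _ _ _).trans (gen_word _ _ _ _ l)
  · exact (RingQuot.liftAlgHom_mkAlgHom_apply _ _ _ _).trans (gen_E _ _ _ _ i)
  · intro φ hw he r a
    obtain ⟨x, rfl⟩ := RingQuot.mkAlgHom_surjective ℂ (BRel (2 * lv) μ0 μ1 τ0 τ1) a
    let ψ : FreeAlgebra ℂ (Gen (2 * lv)) →ₐ[ℂ] Module.End ℂ (ZMod (2 * lv) → ℂ) :=
      φ.comp (RingQuot.mkAlgHom ℂ (BRel (2 * lv) μ0 μ1 τ0 τ1))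
    change ∀ f, f ∈ paritySub (2 * lv) (r : ℕ) → ψ x f ∈ paritySub (2 * lv) (r : ℕ)
    induction x using FreeAlgebra.induction with
    | grade0 c =>
      intro f hf
      rw [AlgHom.commutes, Module.algebraMap_end_apply]
      exact Submodule.smul_mem _ _ hf
    | grade1 g =>
      intro f hf
      rcases g with t | i
      · have h1 : ψ (FreeAlgebra.ι ℂ (Sum.inl t)) = rho (2 * lv) (wordG (2 * lv) [t]) := by
          rw [← hw [t]]
          simp only [wbar, wordA, List.map_cons, List.map_nil, List.prod_cons, List.prod_nil,
            mul_one]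
          rfl
        rw [h1]
        exact rho_par _ _ _ hf
      · have h1 : ψ (FreeAlgebra.ι ℂ (Sum.inr i)) = pV (2 * lv) μ0 μ1 τ0 τ1 i := he i
        rw [h1]
        exact pV_par _ _ _ _ _ _ _ hf
    | mul x y hx hy =>
      intro f hf
      rw [map_mul, Module.End.mul_apply]
      exact hx _ (hy _ hf)
    | add x y hx hy =>
      intro f hf
      rw [map_add, LinearMap.add_apply]
      exact Submodule.add_mem _ (hx _ hf) (hy _ hf)
end
end

section
/- Let M⁰ = (m⁰_{ij}) and M¹ = (m¹_{ij}) be the l×l matrices defined by p_{2(i−1)}(v_{2(j−1)}) = m⁰_{ij} v_{2(i−1)} and p_{2i−1}(v_{2j−1}) = m¹_{ij} v_{2i−1} (1 ≤ i, j ≤ l). If det M⁰ ≠ 0 (respectively det M¹ ≠ 0), then Kr⁰ (respectively Kr¹) is an irreducible representation of B_{G_m}(Υ); when both determinants are nonzero, Kr⁰ and Kr¹ are inequivalent to each other, and each is inequivalent to every representation that factors through the projection π : B_{G_m}(Υ) → ℂG_m sending every e_i to 0. -/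
noncomputable section
open scoped Classical

namespace DihEven

section aux
variable {lv : ℕ} [NeZero (2 * lv)]

theorem aux_val (j : Fin lv) (r : Fin 2) :
    ((2 * (j : ℕ) + (r : ℕ) : ℕ) : ZMod (2 * lv)).val = 2 * (j : ℕ) + (r : ℕ) := by
  apply ZMod.val_natCast_of_lt
  have := j.2
  have := r.2
  omega

theorem aux_exists (r : Fin 2) (i : ZMod (2 * lv)) (hi : i.val % 2 = (r : ℕ)) :
    ∃ j : Fin lv, ((2 * (j : ℕ) + (r : ℕ) : ℕ) : ZMod (2 * lv)) = i := by
  have h1 := ZMod.val_lt i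
  refine ⟨⟨i.val / 2, by omega⟩, ?_⟩
  apply ZMod.val_injective
  rw [aux_val]
  simp only
  omega

theorem aux_sum (r : Fin 2) (c f : ZMod (2 * lv) → ℂ)
    (hf : f ∈ paritySub (2 * lv) (r : ℕ)) :
    ∑ j : Fin lv, c ((2 * (j : ℕ) + (r : ℕ) : ℕ) : ZMod (2 * lv)) *
        f ((2 * (j : ℕ) + (r : ℕ) : ℕ) : ZMod (2 * lv)) = ∑ j', c j' * f j' := by
  refine Finset.sum_of_injOn
    (fun j : Fin lv => ((2 * (j : ℕ) + (r : ℕ) : ℕ) : ZMod (2 * lv))) ?_ ?_ ?_ ?_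
  · intro a _ b _ h
    have h2 := congrArg ZMod.val h
    simp only [aux_val] at h2
    apply Fin.ext
    omega
  · intro a _
    simp
  · intro i _ hi
    by_cases h : i.val % 2 = (r : ℕ)
    · obtain ⟨j, hj⟩ := aux_exists r i h
      exact absurd ⟨j, by simp, hj⟩ hi
    · rw [hf i h, mul_zero]
  · intro i _
    rfl

theorem aux_pV (μ0 μ1 τ0 τ1 : ℂ) (r : Fin 2)
    (hd : (MV (2 * lv) lv μ0 μ1 τ0 τ1 (r : ℕ)).det ≠ 0) (f : ZMod (2 * lv) → ℂ)
    (hf : f ∈ paritySub (2 * lv) (r : ℕ)) (h0 : f ≠ 0) :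
    ∃ i : ZMod (2 * lv), i.val % 2 = (r : ℕ) ∧
      ∑ j', coefV (2 * lv) μ0 μ1 τ0 τ1 i j' * f j' ≠ 0 := by
  by_contra hcon
  push Not at hcon
  have hv : (MV (2 * lv) lv μ0 μ1 τ0 τ1 (r : ℕ)).mulVec
      (fun j : Fin lv => f ((2 * (j : ℕ) + (r : ℕ) : ℕ) : ZMod (2 * lv))) = 0 := by
    funext i
    have h1 := hcon ((2 * (i : ℕ) + (r : ℕ) : ℕ) : ZMod (2 * lv)) (by
      rw [aux_val]; have := r.2; omega)
    rw [← aux_sum r _ f hf] at h1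
    exact h1
  have h2 := Matrix.eq_zero_of_mulVec_eq_zero hd hv
  apply h0
  funext i
  by_cases h : i.val % 2 = (r : ℕ)
  · obtain ⟨j, hj⟩ := aux_exists r i h
    have := congrFun h2 j
    rw [← hj]
    exact this
  · exact hf i h

theorem aux_pV_eq (μ0 μ1 τ0 τ1 : ℂ) (i : ZMod (2 * lv)) (f : ZMod (2 * lv) → ℂ) :
    pV (2 * lv) μ0 μ1 τ0 τ1 i f =
      (∑ j', coefV (2 * lv) μ0 μ1 τ0 τ1 i j' * f j') • Pi.single i (1 : ℂ) := by
  funext t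
  by_cases h : t = i
  · subst h
    simp [pV]
  · simp [pV, h]

theorem aux_single_mem (r : ℕ) (i : ZMod (2 * lv)) (hi : i.val % 2 = r) :
    (Pi.single i (1 : ℂ) : ZMod (2 * lv) → ℂ) ∈ paritySub (2 * lv) r := by
  intro j hj
  have : j ≠ i := by rintro rfl; exact hj hi
  simp [this]

theorem aux_rho (i : ZMod (2 * lv)) :
    rho (2 * lv) (wordG (2 * lv) [1, 0]) (Pi.single i (1 : ℂ)) = Pi.single (i + 2) 1 := by
  funext j
  have h : conjIdx (2 * lv) (wordG (2 * lv) [1, 0])⁻¹ j = j - 2 := by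
    simp [conjIdx, wordG]
    ring
  simp only [rho, LinearMap.coe_mk, AddHom.coe_mk, h, Pi.single_apply, sub_eq_iff_eq_add]

theorem aux_nonzero (hl : 2 ≤ lv) (r : Fin 2) : ∃ f : ZMod (2 * lv) → ℂ,
    f ∈ paritySub (2 * lv) (r : ℕ) ∧ f ≠ 0 := by
  refine ⟨Pi.single ((2 * ((⟨0, by omega⟩ : Fin lv) : ℕ) + (r : ℕ) : ℕ) : ZMod (2 * lv)) 1,
    aux_single_mem _ _ ?_, ?_⟩
  · rw [aux_val]; have := r.2; simp only; omega
  · intro h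
    rw [Pi.single_eq_zero_iff] at h
    exact one_ne_zero h

end aux

end DihEven

open DihEven in
/-- for `m = 2l` even, if `det M⁰ ≠ 0` (resp. `det M¹ ≠ 0`) then the
subrepresentation `Kr⁰` (resp. `Kr¹`) of the generalized Lawrence–Krammer representation
is irreducible; when both determinants are nonzero, `Kr⁰` and `Kr¹` are inequivalent,
and each is inequivalent to every representation factoring through
`π : B_{G_m}(Υ) → ℂG_m` (i.e. killing all `e_i`). -/
theorem dihedral_even_LK_subrepresentations (lv : ℕ) (hl : 2 ≤ lv) [NeZero (2 * lv)]
    (μ0 μ1 τ0 τ1 : ℂ)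
    (φ : BEven (2 * lv) μ0 μ1 τ0 τ1 →ₐ[ℂ] Module.End ℂ (ZMod (2 * lv) → ℂ))
    (hφw : ∀ l : List (Fin 2),
      φ (wbar (2 * lv) μ0 μ1 τ0 τ1 l) = rho (2 * lv) (wordG (2 * lv) l))
    (hφe : ∀ i : ZMod (2 * lv),
      φ (ebar (2 * lv) μ0 μ1 τ0 τ1 i) = pV (2 * lv) μ0 μ1 τ0 τ1 i) :
    (∀ r : Fin 2, (MV (2 * lv) lv μ0 μ1 τ0 τ1 (r : ℕ)).det ≠ 0 →
      ∀ U : Submodule ℂ (ZMod (2 * lv) → ℂ), U ≤ paritySub (2 * lv) (r : ℕ) →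
        (∀ (a : BEven (2 * lv) μ0 μ1 τ0 τ1) (f : ZMod (2 * lv) → ℂ),
          f ∈ U → φ a f ∈ U) →
        U = ⊥ ∨ U = paritySub (2 * lv) (r : ℕ)) ∧
    ((MV (2 * lv) lv μ0 μ1 τ0 τ1 0).det ≠ 0 → (MV (2 * lv) lv μ0 μ1 τ0 τ1 1).det ≠ 0 →
      (¬ ∃ T : (ZMod (2 * lv) → ℂ) →ₗ[ℂ] (ZMod (2 * lv) → ℂ),
        (∀ f ∈ paritySub (2 * lv) 0, T f ∈ paritySub (2 * lv) 1) ∧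
        (∀ f ∈ paritySub (2 * lv) 0, T f = 0 → f = 0) ∧
        (∀ g ∈ paritySub (2 * lv) 1, ∃ f ∈ paritySub (2 * lv) 0, T f = g) ∧
        (∀ (a : BEven (2 * lv) μ0 μ1 τ0 τ1) (f : ZMod (2 * lv) → ℂ),
          f ∈ paritySub (2 * lv) 0 → T (φ a f) = φ a (T f))) ∧
      (∀ r : Fin 2, ∀ (W : Type) (_ : AddCommGroup W), ∀ (_ : Module ℂ W)
        (ψ : BEven (2 * lv) μ0 μ1 τ0 τ1 →ₐ[ℂ] Module.End ℂ W),
        (∀ i : ZMod (2 * lv), ψ (ebar (2 * lv) μ0 μ1 τ0 τ1 i) = 0) →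
        ¬ ∃ T : (ZMod (2 * lv) → ℂ) →ₗ[ℂ] W,
          (∀ f ∈ paritySub (2 * lv) (r : ℕ), T f = 0 → f = 0) ∧
          (∀ w : W, ∃ f ∈ paritySub (2 * lv) (r : ℕ), T f = w) ∧
          (∀ (a : BEven (2 * lv) μ0 μ1 τ0 τ1) (f : ZMod (2 * lv) → ℂ),
            f ∈ paritySub (2 * lv) (r : ℕ) → T (φ a f) = ψ a (T f)))) := by
  refine ⟨?_, ?_⟩
  · intro r hd U hU hinv
    by_cases hbot : U = ⊥
    · exact Or.inl hbot
    right
    refine le_antisymm hU ?_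
    obtain ⟨f, hfU, hf0⟩ := (Submodule.ne_bot_iff U).1 hbot
    obtain ⟨i, hi, hs⟩ := aux_pV μ0 μ1 τ0 τ1 r hd f (hU hfU) hf0
    have h1 := hinv (ebar (2 * lv) μ0 μ1 τ0 τ1 i) f hfU
    rw [hφe, aux_pV_eq] at h1
    have hvi : (Pi.single i (1 : ℂ) : ZMod (2 * lv) → ℂ) ∈ U :=
      (Submodule.smul_mem_iff U hs).1 h1
    have hshift : ∀ n : ℕ,
        (Pi.single (i + 2 * (n : ZMod (2 * lv))) (1 : ℂ) : ZMod (2 * lv) → ℂ) ∈ U := by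
      intro n
      induction n with
      | zero => simpa using hvi
      | succ n ih =>
        have h2 := hinv (wbar (2 * lv) μ0 μ1 τ0 τ1 [1, 0]) _ ih
        rw [hφw, aux_rho] at h2
        convert h2 using 2
        push_cast
        ring
    have hall : ∀ k : ZMod (2 * lv), k.val % 2 = (r : ℕ) →
        (Pi.single k (1 : ℂ) : ZMod (2 * lv) → ℂ) ∈ U := by
      intro k hk
      have hilt := ZMod.val_lt i
      have h3 := hshift ((k.val + 2 * lv - i.val) / 2)
      convert h3 using 2
      have h4 : k.val + 2 * lv = i.val + 2 * ((k.val + 2 * lv - i.val) / 2) := by omega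
      have h5 := congrArg (fun n : ℕ => (n : ZMod (2 * lv))) h4
      simp only [Nat.cast_add, ZMod.natCast_val, ZMod.cast_id', id, ZMod.natCast_self,
        add_zero] at h5
      refine h5.trans ?_
      rw [Nat.cast_mul]
      rfl
    intro g hg
    rw [pi_eq_sum_univ g]
    refine Submodule.sum_mem _ fun k _ => ?_
    by_cases hk : k.val % 2 = (r : ℕ)
    · refine Submodule.smul_mem _ _ ?_
      convert hall k hk using 1
      funext j
      simp [Pi.single_apply, eq_comm]
    · rw [hg k hk, zero_smul]
      exact Submodule.zero_mem _
  · intro hd0 hd1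
    refine ⟨?_, ?_⟩
    · rintro ⟨T, hT1, hT2, -, hT4⟩
      obtain ⟨f, hf, hf0⟩ := aux_nonzero hl 0
      obtain ⟨i, hi, hs⟩ := aux_pV μ0 μ1 τ0 τ1 0 hd0 f hf hf0
      have h1 := hT4 (ebar (2 * lv) μ0 μ1 τ0 τ1 i) f hf
      rw [hφe, aux_pV_eq, aux_pV_eq] at h1
      have h2 : ∑ j', coefV (2 * lv) μ0 μ1 τ0 τ1 i j' * (T f) j' = 0 := by
        refine Finset.sum_eq_zero fun j _ => ?_
        by_cases hj : j.val % 2 = 1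
        · have hji : j ≠ i := by
            rintro rfl
            simp [hj] at hi
          have hpar : ¬ j.val % 2 = i.val % 2 := by
            rw [hj, hi]; simp
          rw [coefV, if_neg hji, if_neg hpar, zero_mul]
        · rw [hT1 f hf j hj, mul_zero]
      rw [h2, zero_smul] at h1
      have h3 := hT2 _ (Submodule.smul_mem _ _ (aux_single_mem 0 i hi)) h1
      rcases smul_eq_zero.1 h3 with h | h
      · exact hs h
      · rw [Pi.single_eq_zero_iff] at h
        exact one_ne_zero h
    · intro r W _ _ ψ hψ
      rintro ⟨T, hT2, -, hT4⟩
      have hd : (MV (2 * lv) lv μ0 μ1 τ0 τ1 (r : ℕ)).det ≠ 0 := by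
        fin_cases r
        · exact hd0
        · exact hd1
      obtain ⟨f, hf, hf0⟩ := aux_nonzero hl r
      obtain ⟨i, hi, hs⟩ := aux_pV μ0 μ1 τ0 τ1 r hd f hf hf0
      have h1 := hT4 (ebar (2 * lv) μ0 μ1 τ0 τ1 i) f hf
      rw [hφe, aux_pV_eq, hψ, LinearMap.zero_apply] at h1
      have h3 := hT2 _ (Submodule.smul_mem _ _ (aux_single_mem _ i hi)) h1
      rcases smul_eq_zero.1 h3 with h | h
      · exact hs h
      · rw [Pi.single_eq_zero_iff] at h
        exact one_ne_zero h
end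
end

section
/- Suppose the finite Coxeter group G acts on a set S and there exist elements v₁, …, vₙ ∈ S such that: (1) if m_{ij} = 2k+1 then [s_is_j⋯]_{2k}·v_i = v_j; (2) if m_{ij} = 2k then [s_is_j⋯]_{2k−1}·v_j = v_j; (3) if m_{ij} = 2 then s_i·v_j = v_j; and (4) s_i·v_i = v_i for all i. Then for every w ∈ G and all indices i, j, the identity w s_i w⁻¹ = s_j in G implies w·v_i = v_j. -/
/-- The alternating word `[i, j, i, j, ...]` of length `r`, starting with `i`. -/
def altWord {B : Type*} (i j : B) : ℕ → List B
  | 0 => []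
  | n + 1 => i :: altWord j i n

namespace CoxGeom

open Polynomial.Chebyshev CoxeterSystem

variable {B : Type*}

noncomputable def al (i : B) : B →₀ ℝ := Finsupp.single i 1

noncomputable def fo (M : CoxeterMatrix B) (i : B) : Module.Dual ℝ (B →₀ ℝ) :=
  Finsupp.lsum ℝ fun k => (-2 * Real.cos (Real.pi / (M i k : ℝ))) • LinearMap.id

lemma fo_al (M : CoxeterMatrix B) (i k : B) :
    fo M i (al k) = -2 * Real.cos (Real.pi / (M i k : ℝ)) := by
  simp [fo, al]

lemma fo_self (M : CoxeterMatrix B) (i : B) : fo M i (al i) = 2 := by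
  simp [fo_al]

noncomputable def refl (M : CoxeterMatrix B) (i : B) : (B →₀ ℝ) ≃ₗ[ℝ] (B →₀ ℝ) :=
  Module.reflection (fo_self M i)

lemma refl_apply (M : CoxeterMatrix B) (i : B) (x : B →₀ ℝ) :
    refl M i x = x - fo M i x • al i := Module.reflection_apply _ _

lemma liftable (M : CoxeterMatrix B) : M.IsLiftable (refl M) := by
  intro i k
  by_cases hik : i = k
  · subst hik
    have : refl M i * refl M i = 1 :=
      LinearEquiv.ext fun x => Module.involutive_reflection (fo_self M i) x
    rw [this, one_pow]
  have h1 := M.off_diagonal i k hik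
  have hs : M k i = M i k := M.symmetric k i
  by_cases h2 : M i k = 2
  · have e1 : fo M i (al k) = 0 := by simp [fo_al, h2]
    have e2 : fo M k (al i) = 0 := by simp [fo_al, hs, h2]
    rw [h2, pow_two]
    apply LinearEquiv.ext
    intro x
    simp only [LinearEquiv.mul_apply, refl_apply, map_sub, map_smul, e1, e2, fo_self,
      LinearEquiv.coe_one, id]
    match_scalars <;> simp <;> ring
  by_cases h0 : M i k = 0
  · simp [h0]
  set m := M i k with hm
  have hm3 : 3 ≤ m := by
    have : m ≠ 1 := h1
    omega
  have hmR : (3 : ℝ) ≤ m := by exact_mod_cast hm3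
  have hsin : Real.sin (2 * Real.pi / m) ≠ 0 := by
    apply ne_of_gt
    apply Real.sin_pos_of_pos_of_lt_pi
    · have := Real.pi_pos; positivity
    · rw [div_lt_iff₀ (by linarith)]; nlinarith [Real.pi_pos]
  have ht : 2 * Real.cos (2 * Real.pi / m) = fo M i (al k) * fo M k (al i) - 2 := by
    rw [fo_al, fo_al, hs, ← hm, mul_div_assoc, Real.cos_two_mul]; ring
  have key := fun n : ℤ => S_two_mul_real_cos (2 * Real.pi / m) n
  have hmm : (m : ℝ) * (2 * Real.pi / m) = 2 * Real.pi := by field_simp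
  have c1 : ((S ℝ ((m - 2) / 2)).eval (2 * Real.cos (2 * Real.pi / m)) *
      ((S ℝ ((m - 1) / 2)).eval (2 * Real.cos (2 * Real.pi / m)) +
       (S ℝ ((m - 3) / 2)).eval (2 * Real.cos (2 * Real.pi / m)))) = 0 ∧
     ((S ℝ ((m - 1) / 2)).eval (2 * Real.cos (2 * Real.pi / m)) *
      ((S ℝ (m / 2)).eval (2 * Real.cos (2 * Real.pi / m)) +
       (S ℝ ((m - 2) / 2)).eval (2 * Real.cos (2 * Real.pi / m)))) = 0 := by
    rcases Nat.even_or_odd' m with ⟨n, hn | hn⟩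
    · have : (S ℝ ((n : ℤ) - 1)).eval (2 * Real.cos (2 * Real.pi / m)) = 0 := by
        have := key ((n : ℤ) - 1)
        have e : (((n : ℤ) - 1 : ℤ) + 1 : ℝ) * (2 * Real.pi / m) = Real.pi := by
          rw [hn] at hmm ⊢; push_cast at hmm ⊢; linarith
        rw [e, Real.sin_pi] at this
        exact (mul_eq_zero.1 this).resolve_right hsin
      have a1 : ((m : ℤ) - 2) / 2 = n - 1 := by omega
      have a2 : ((m : ℤ) - 1) / 2 = n - 1 := by omega
      rw [a1, a2, this]; simp
    · have : (S ℝ (n : ℤ)).eval (2 * Real.cos (2 * Real.pi / m)) +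
          (S ℝ ((n : ℤ) - 1)).eval (2 * Real.cos (2 * Real.pi / m)) = 0 := by
        have k1 := key (n : ℤ)
        have k2 := key ((n : ℤ) - 1)
        have e : (((n : ℤ)  : ℤ) + 1 : ℝ) * (2 * Real.pi / m) =
           2 * Real.pi - (((n : ℤ) - 1 : ℤ) + 1 : ℝ) * (2 * Real.pi / m) := by
          rw [hn] at hmm ⊢; push_cast at hmm ⊢; linarith
        rw [e, Real.sin_two_pi_sub, ← k2] at k1
        apply (mul_eq_zero.1 (?_ : _ * Real.sin (2 * Real.pi / m) = 0)).resolve_right hsin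
        linarith
      have a1 : ((m : ℤ) - 2) / 2 = n - 1 := by omega
      have a2 : ((m : ℤ) - 1) / 2 = n := by omega
      have a3 : ((m : ℤ) - 3) / 2 = n - 1 := by omega
      have a4 : (m : ℤ) / 2 = n := by omega
      rw [a1, a2, a3, a4, this]; simp
  apply LinearEquiv.ext
  intro x
  have := Module.reflection_mul_reflection_pow_apply (fo_self M i) (fo_self M k) m x _ ht
  rw [c1.1, c1.2] at this
  simpa [refl] using this

/-- Dihedral coefficients. -/
noncomputable def U (m : ℕ) (r : ℕ) : ℝ :=
  (S ℝ ((r : ℤ) - 1)).eval (2 * Real.cos (Real.pi / (m : ℝ)))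

lemma U_zero (m : ℕ) : U m 0 = 0 := by simp [U]
lemma U_one (m : ℕ) : U m 1 = 1 := by simp [U]
lemma U_rec (m r : ℕ) :
    U m (r + 2) = 2 * Real.cos (Real.pi / (m : ℝ)) * U m (r + 1) - U m r := by
  have := congrArg (Polynomial.eval (2 * Real.cos (Real.pi / (m : ℝ)))) (S_add_two ℝ ((r : ℤ) - 1))
  simp only [U]
  push_cast
  rw [show (r : ℤ) + 2 - 1 = r - 1 + 2 by ring, this, show (r : ℤ) + 1 - 1 = r - 1 + 1 by ring]
  simp

lemma U_pos (m r : ℕ) (hr : 0 < r) (h1 : m ≠ 1) (h : m = 0 ∨ r < m) : 0 < U m r := by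
  by_cases h0 : m = 0
  · subst h0
    simp [U, S_eval_two, hr]
  have hrm : r < m := h.resolve_left h0
  have hmR : (2 : ℝ) ≤ m := by exact_mod_cast (by omega : 2 ≤ m)
  have hsin : 0 < Real.sin (Real.pi / m) := by
    apply Real.sin_pos_of_pos_of_lt_pi
    · have := Real.pi_pos; positivity
    · rw [div_lt_iff₀ (by linarith)]; nlinarith [Real.pi_pos]
  have key := S_two_mul_real_cos (Real.pi / m) ((r : ℤ) - 1)
  have : 0 < Real.sin ((((r : ℤ) - 1 : ℤ) + 1 : ℝ) * (Real.pi / m)) := by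
    have hrR : (r : ℝ) < m := by exact_mod_cast hrm
    have hr0 : (0 : ℝ) < r := by exact_mod_cast hr
    push_cast
    rw [sub_add_cancel]
    apply Real.sin_pos_of_pos_of_lt_pi
    · have := Real.pi_pos; positivity
    · rw [← mul_div_assoc, div_lt_iff₀ (by linarith)]; nlinarith [Real.pi_pos]
  rw [← key] at this
  exact pos_of_mul_pos_left this hsin.le

lemma U_self (m : ℕ) (h1 : m ≠ 1) : U m m = 0 := by
  by_cases h0 : m = 0
  · subst h0
    simp [U, S_eval_two]
  have hmR : (2 : ℝ) ≤ m := by exact_mod_cast (by omega : 2 ≤ m)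
  have hsin : 0 < Real.sin (Real.pi / m) := by
    apply Real.sin_pos_of_pos_of_lt_pi
    · have := Real.pi_pos; positivity
    · rw [div_lt_iff₀ (by linarith)]; nlinarith [Real.pi_pos]
  have key := S_two_mul_real_cos (Real.pi / m) ((m : ℤ) - 1)
  have e : (((m : ℤ) - 1 : ℤ) + 1 : ℝ) * (Real.pi / m) = Real.pi := by
    push_cast; field_simp; ring
  rw [e, Real.sin_pi] at key
  exact (mul_eq_zero.1 key).resolve_right hsin.ne'

variable {W : Type*} [Group W] {M : CoxeterMatrix B} (cs : CoxeterSystem M W)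

noncomputable def rho : W →* ((B →₀ ℝ) ≃ₗ[ℝ] (B →₀ ℝ)) := cs.lift ⟨refl M, liftable M⟩

lemma rho_simple (i : B) (x : B →₀ ℝ) :
    rho cs (cs.simple i) x = x - fo M i x • al i := by
  rw [rho, cs.lift_apply_simple, refl_apply]

lemma dihedral (i k : B) (r : ℕ) :
    rho cs (cs.wordProd (alternatingWord i k r)) (al i) =
      U (M i k) (r + 1) • al (if Even r then i else k) +
      U (M i k) r • al (if Even r then k else i) := by
  have hs : M k i = M i k := M.symmetric k i
  induction r with
  | zero => simp [alternatingWord, U_zero, U_one]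
  | succ r ih =>
    rw [alternatingWord_succ', wordProd_cons, map_mul, LinearEquiv.mul_apply, ih, rho_simple,
      U_rec]
    by_cases h : Even r
    · have h' : ¬ Even (r + 1) := by rwa [Nat.even_add_one, not_not]
      simp only [h, h', if_true, if_false, map_add, map_smul, fo_self, fo_al, hs, smul_eq_mul]
      module
    · have h' : Even (r + 1) := by rwa [Nat.even_add_one]
      simp only [h, h', if_true, if_false, map_add, map_smul, fo_self, fo_al, hs, smul_eq_mul]
      module

lemma wordlen (i k : B) (r : ℕ) : cs.length (cs.wordProd (alternatingWord i k r)) ≤ r := by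
  simpa using cs.length_wordProd_le (alternatingWord i k r)

def Dec (w : W) (i k : B) (r : ℕ) : Prop :=
  ∃ w', w = w' * cs.wordProd (alternatingWord i k r) ∧ cs.length w = cs.length w' + r

lemma Dec_pred (w : W) (i k : B) (r : ℕ) (h : Dec cs w i k (r + 1)) : Dec cs w i k r := by
  obtain ⟨w', rfl, hl⟩ := h
  rw [alternatingWord_succ', wordProd_cons] at *
  set p := (if Even r then k else i)
  refine ⟨w' * cs.simple p, by rw [mul_assoc], ?_⟩
  have h1 := cs.length_mul_le (w' * cs.simple p) (cs.wordProd (alternatingWord i k r))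
  rw [mul_assoc] at h1
  have h2 := wordlen cs i k r
  have h3 := cs.length_mul_simple w' p
  omega

lemma Dec_le (w : W) (i k : B) {r r' : ℕ} (hr : r ≤ r') (h : Dec cs w i k r') : Dec cs w i k r := by
  induction hr with
  | refl => exact h
  | step _ ih => exact ih (Dec_pred cs _ _ _ _ h)

lemma Dec_lt (w : W) (i k : B) {r : ℕ} (h : Dec cs w i k r)
    (hi : cs.length (w * cs.simple i) = cs.length w + 1) : M i k = 0 ∨ r < M i k := by
  by_contra! hc
  obtain ⟨w', e, hl⟩ := Dec_le cs w i k hc.2 h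
  have hb : cs.wordProd (alternatingWord i k (M i k)) =
      cs.wordProd (alternatingWord k i (M i k)) := by
    have := cs.wordProd_braidWord_eq i k
    simpa [braidWord, M.symmetric k i] using this
  obtain ⟨n, hn⟩ := Nat.exists_eq_succ_of_ne_zero hc.1
  have e2 : w * cs.simple i = w' * cs.wordProd (alternatingWord i k n) := by
    rw [e, hb, hn, alternatingWord_succ, wordProd_concat]
    simp [mul_assoc]
  have h1 := cs.length_mul_le w' (cs.wordProd (alternatingWord i k n))
  have h2 := wordlen cs i k n
  rw [← e2] at h1
  omega

lemma exists_dec (w : W) (i k : B)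
    (hi : cs.length (w * cs.simple i) = cs.length w + 1)
    (hk : cs.length (w * cs.simple k) + 1 = cs.length w) :
    ∃ r w', 0 < r ∧ (M i k = 0 ∨ r < M i k) ∧
      w = w' * cs.wordProd (alternatingWord i k r) ∧ cs.length w = cs.length w' + r ∧
      cs.length (w' * cs.simple i) = cs.length w' + 1 ∧
      cs.length (w' * cs.simple k) = cs.length w' + 1 := by
  classical
  have hd1 : Dec cs w i k 1 := ⟨w * cs.simple k, by simp [alternatingWord], by omega⟩
  have hbd : ∀ r, Dec cs w i k r → r ≤ cs.length w := by
    rintro r ⟨w', -, h⟩; omega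
  set r := Nat.findGreatest (Dec cs w i k) (cs.length w) with hr
  have hdr : Dec cs w i k r := Nat.findGreatest_spec (hbd 1 hd1) hd1
  have h1r : 1 ≤ r := Nat.le_findGreatest (hbd 1 hd1) hd1
  have hmax : ¬ Dec cs w i k (r + 1) := by
    intro h
    have : r + 1 ≤ r := Nat.le_findGreatest (hbd _ h) h
    omega
  obtain ⟨w', e, hl⟩ := hdr
  have hlt := Dec_lt cs w i k ⟨w', e, hl⟩ hi
  obtain ⟨q, hq⟩ := Nat.exists_eq_succ_of_ne_zero (by omega : r ≠ 0)
  clear_value r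
  have A : cs.length (w' * cs.simple (if Even r then k else i)) = cs.length w' + 1 := by
    rcases cs.length_mul_simple w' (if Even r then k else i) with h | h
    · exact h
    · exfalso
      apply hmax
      refine ⟨w' * cs.simple (if Even r then k else i), ?_, by omega⟩
      rw [alternatingWord_succ', wordProd_cons, e]
      simp [mul_assoc]
  have A' : cs.length (w' * cs.simple (if Even r then i else k)) = cs.length w' + 1 := by
    rcases cs.length_mul_simple w' (if Even r then i else k) with h | h
    · exact h
    · exfalso
      have e2 : w = w' * cs.simple (if Even r then i else k) *
          cs.wordProd (alternatingWord i k q) := by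
        rw [e, hq, Nat.succ_eq_add_one, alternatingWord_succ', wordProd_cons]
        by_cases hE : Even q <;> simp [hE, Nat.even_add_one, mul_assoc]
      have h1 := cs.length_mul_le (w' * cs.simple (if Even r then i else k))
        (cs.wordProd (alternatingWord i k q))
      have h2 := wordlen cs i k q
      rw [← e2] at h1
      omega
  refine ⟨r, w', by omega, hlt, e, hl, ?_, ?_⟩
  · by_cases hE : Even r
    · simpa [hE] using A'
    · simpa [hE] using A
  · by_cases hE : Even r
    · simpa [hE] using A
    · simpa [hE] using A'

lemma altWord_even (i k : B) (n : ℕ) : alternatingWord i k (2 * n) = altWord i k (2 * n) ∧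
    alternatingWord i k (2 * n + 1) = altWord k i (2 * n + 1) := by
  induction n with
  | zero => simp [alternatingWord, altWord]
  | succ n ih =>
    have h1 : alternatingWord i k (2 * (n + 1)) = altWord i k (2 * (n + 1)) := by
      rw [show 2 * (n + 1) = 2 * n + 1 + 1 by ring, alternatingWord_succ', ih.2]
      simp [altWord]
    refine ⟨h1, ?_⟩
    rw [alternatingWord_succ', h1]
    simp [altWord]

lemma al_apply_ne {i j : B} (h : i ≠ j) : al i j = 0 := by
  classical
  simp [al, Finsupp.single_apply, h]

lemma al_apply_self {i : B} : al i i = 1 := by simp [al]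

/-- If a positive combination of two nonnegative vectors is proportional to `al j`, then the
first one is as well. -/
lemma supp {x y : B →₀ ℝ} (hx : 0 ≤ x) (hy : 0 ≤ y) {a b c : ℝ} (ha : 0 < a) (hb : 0 < b)
    {j : B} (h : a • x + b • y = c • al j) : x = x j • al j ∧ y = y j • al j := by
  have : ∀ l, l ≠ j → x l = 0 ∧ y l = 0 := by
    intro l hl
    have h' := DFunLike.congr_fun h l
    simp only [Finsupp.add_apply, Finsupp.smul_apply, smul_eq_mul, al_apply_ne hl.symm,
      mul_zero] at h'
    have h1 : 0 ≤ x l := hx l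
    have h2 : 0 ≤ y l := hy l
    have h3 := mul_nonneg ha.le h1
    have h4 := mul_nonneg hb.le h2
    constructor
    · exact (mul_eq_zero.1 (by linarith : a * x l = 0)).resolve_left ha.ne'
    · exact (mul_eq_zero.1 (by linarith : b * y l = 0)).resolve_left hb.ne'
  constructor
  · ext l
    by_cases hl : l = j
    · subst hl; simp [al_apply_self]
    · simp [(this l hl).1, al_apply_ne (Ne.symm hl)]
  · ext l
    by_cases hl : l = j
    · subst hl; simp [al_apply_self]
    · simp [(this l hl).2, al_apply_ne (Ne.symm hl)]

lemma al_nonneg (i : B) : 0 ≤ al i := by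
  simp [al]

lemma not_both (g : (B →₀ ℝ) ≃ₗ[ℝ] (B →₀ ℝ)) {i k j : B} (hik : i ≠ k) {c d : ℝ}
    (h1 : g (al i) = c • al j) (h2 : g (al k) = d • al j) : False := by
  have : g (d • al i) = g (c • al k) := by
    rw [map_smul, map_smul, h1, h2, smul_comm]
  have h := g.injective this
  have hd : d = 0 := by
    have := DFunLike.congr_fun h i
    simpa [al_apply_self, al_apply_ne hik.symm] using this
  rw [hd, zero_smul, ← map_zero g] at h2
  have := DFunLike.congr_fun (g.injective h2) k
  simp [al_apply_self] at this

lemma main {S : Type*} [MulAction W S] (v : B → S)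
    (h1 : ∀ i j : B, ∀ k : ℕ, M i j = 2 * k + 1 →
      cs.wordProd (altWord i j (2 * k)) • v i = v j)
    (h2 : ∀ i j : B, ∀ k : ℕ, M i j = 2 * k →
      cs.wordProd (altWord i j (2 * k - 1)) • v j = v j) (n : ℕ) :
    ∀ (w : W) (i : B), cs.length w = n → cs.length (w * cs.simple i) = cs.length w + 1 →
      0 ≤ rho cs w (al i) ∧ ∀ (j : B) (c : ℝ), rho cs w (al i) = c • al j → w • v i = v j := by
  induction n using Nat.strong_induction_on with
  | _ n ih =>
  intro w i hn hi
  by_cases hw : w = 1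
  · subst hw
    refine ⟨by simpa using al_nonneg i, fun j c h => ?_⟩
    have : i = j := by
      by_contra hij
      have := DFunLike.congr_fun h i
      simp [al_apply_self, al_apply_ne (Ne.symm hij)] at this
    rw [this, one_smul]
  obtain ⟨k, hk⟩ := cs.exists_rightDescent_of_ne_one hw
  rw [cs.isRightDescent_iff] at hk
  have hik : i ≠ k := by rintro rfl; omega
  have hM1 := M.off_diagonal i k hik
  obtain ⟨r, w', hr, hrm, e, hl, hi', hk'⟩ := exists_dec cs w i k hi hk
  obtain ⟨pi, qi⟩ := ih (cs.length w') (by omega) w' i rfl hi'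
  obtain ⟨pk, qk⟩ := ih (cs.length w') (by omega) w' k rfl hk'
  have key : rho cs w (al i) =
      U (M i k) (r + 1) • rho cs w' (al (if Even r then i else k)) +
      U (M i k) r • rho cs w' (al (if Even r then k else i)) := by
    rw [e, map_mul, LinearEquiv.mul_apply, dihedral, map_add, map_smul, map_smul]
  have Ur : 0 < U (M i k) r := U_pos _ _ hr hM1 hrm
  have pa : 0 ≤ rho cs w' (al (if Even r then i else k)) := by split_ifs <;> assumption
  have pb : 0 ≤ rho cs w' (al (if Even r then k else i)) := by split_ifs <;> assumption
  by_cases hlast : r + 1 = M i k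
  · have U0 : U (M i k) (r + 1) = 0 := by rw [hlast]; exact U_self _ hM1
    rw [U0, zero_smul, zero_add] at key
    refine ⟨by rw [key]; exact smul_nonneg Ur.le pb, fun j c h => ?_⟩
    rw [key] at h
    have h' : rho cs w' (al (if Even r then k else i)) = (c / U (M i k) r) • al j := by
      rw [div_eq_inv_mul, mul_smul, ← h, smul_smul, inv_mul_cancel₀ Ur.ne', one_smul]
    rw [e, mul_smul]
    rcases Nat.even_or_odd' r with ⟨p, rfl | rfl⟩
    · rw [(altWord_even i k p).1, h1 i k p hlast.symm]
      simp only [even_two, Even.mul_right, if_true] at h'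
      exact qk _ _ h'
    · have := h2 k i (p + 1) (by rw [M.symmetric k i]; omega)
      rw [(altWord_even i k p).2, show 2 * p + 1 = 2 * (p + 1) - 1 by omega, this]
      have hE : ¬ Even (2 * p + 1) := by simp
      simp only [hE, if_false] at h'
      exact qi _ _ h'
  · have Ur1 : 0 < U (M i k) (r + 1) := U_pos _ _ (by omega) hM1 (by omega)
    refine ⟨by rw [key]; exact add_nonneg (smul_nonneg Ur1.le pa) (smul_nonneg Ur.le pb),
      fun j c h => ?_⟩
    exfalso
    rw [key] at h
    obtain ⟨s1, s2⟩ := supp pa pb Ur1 Ur h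
    refine not_both (rho cs w') ?_ s1 s2
    split_ifs
    · exact hik
    · exact hik.symm

lemma prop_root (w : W) (i j : B) (h : w * cs.simple i * w⁻¹ = cs.simple j) :
    ∃ c : ℝ, rho cs w (al i) = c • al j := by
  have h' : w * cs.simple i = cs.simple j * w := by rw [← h]; group
  have := congrArg (fun x => rho cs x (al i)) h'
  simp only [map_mul, LinearEquiv.mul_apply, rho_simple, map_sub, map_smul, fo_self] at this
  refine ⟨fo M j (rho cs w (al i)) / 2, ?_⟩
  rw [div_eq_inv_mul, mul_smul]
  have h3 : fo M j (rho cs w (al i)) • al j = (2 : ℝ) • rho cs w (al i) := by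
    rw [sub_right_inj] at this
    exact this.symm
  rw [h3, smul_smul]; norm_num

end CoxGeom

/-- if a finite Coxeter group `G` acts on a set `S` and elements
`v i ∈ S` satisfy the listed compatibilities with the alternating words, then any
identity `w * sᵢ * w⁻¹ = sⱼ` in `G` implies `w • v i = v j`. -/
theorem coxeter_conjugation_moves_basepoints
    {B W S : Type*} [Group W] (M : CoxeterMatrix B) (cs : CoxeterSystem M W)
    [Finite W] [MulAction W S] (v : B → S)
    (h1 : ∀ i j : B, ∀ k : ℕ, M i j = 2 * k + 1 →
      cs.wordProd (altWord i j (2 * k)) • v i = v j)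
    (h2 : ∀ i j : B, ∀ k : ℕ, M i j = 2 * k →
      cs.wordProd (altWord i j (2 * k - 1)) • v j = v j)
    (h3 : ∀ i j : B, M i j = 2 → cs.simple i • v j = v j)
    (h4 : ∀ i : B, cs.simple i • v i = v i) :
    ∀ (w : W) (i j : B), w * cs.simple i * w⁻¹ = cs.simple j → w • v i = v j := by
  intro w i j h
  have key : ∀ w : W, cs.length (w * cs.simple i) = cs.length w + 1 →
      w * cs.simple i * w⁻¹ = cs.simple j → w • v i = v j := by
    intro w hl h
    obtain ⟨c, hc⟩ := CoxGeom.prop_root cs w i j h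
    exact (CoxGeom.main cs v h1 h2 _ w i rfl hl).2 j c hc
  rcases cs.length_mul_simple w i with hl | hl
  · exact key w hl h
  · have := key (w * cs.simple i) (by simp [hl]) (by rw [← h]; simp [mul_assoc])
    rwa [mul_smul, h4] at this
end

section
/- (1) Let H_i, H_j be reflection hyperplanes with R(i,j) = ∅ and s_is_j ≠ s_js_i, and let s_k = s_is_js_i. If μ_i + μ_{[n+i]} − τ_k ≠ 0 and μ_i − μ_{[n+i]} − τ_k ≠ 0, then for every finite-dimensional irreducible representation (V, ρ) of the algebra \hat{B}_G(Υ): ρ(e_i)ρ(e_j) = ρ(e_j)ρ(e_i) = 0. (2) Let H_i, H_j be reflection hyperplanes with R(i,j) = ∅ and s_is_j = s_js_i. If τ₀(μ₁ + μ₀) ≠ 0, τ₀(μ₁ − μ₀) ≠ 0, μ₂ + μ_{[n+2]} − τ₄ ≠ 0 and μ₂ − μ_{[n+2]} − τ₄ ≠ 0, then for every finite-dimensional irreducible representation (V, ρ) of \hat{B}_G(Υ): ρ(e_i)ρ(e_j) = ρ(e_j)ρ(e_i) = 0. -/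
noncomputable section
open scoped Classical

namespace DihHat

open DihedralGroup

variable (m : ℕ)

/-- Generators of `B̂_G(Υ)` for `G` the dihedral group of type `I₂(m)`:
`inl w = w̄` for `w ∈ G`, `inr i = e_i` for the reflection line `H_i`. -/
abbrev Gen := DihedralGroup m ⊕ ZMod m

/-- The generator `w̄` in the free algebra. -/
def gW (w : DihedralGroup m) : FreeAlgebra ℂ (Gen m) := FreeAlgebra.ι ℂ (Sum.inl w)

/-- The generator `e_i` in the free algebra. -/
def gE (i : ZMod m) : FreeAlgebra ℂ (Gen m) := FreeAlgebra.ι ℂ (Sum.inr i)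

/-- The index `w(i)` defined by `w sᵢ w⁻¹ = s_{w(i)}` (equivalently `w(H_i) = H_{w(i)}`)
in the dihedral group; here `sᵢ = sr i` is the reflection in the line `H_i`. -/
def conjIdx (w : DihedralGroup m) (i : ZMod m) : ZMod m :=
  match w * sr i * w⁻¹ with
  | r _ => 0
  | sr a => a

/-- `n` as an element of `ZMod (2n)` (so that `{c, c + n}` are the two solutions of
`2x = i + j`). -/
def nZ : ZMod m := ((m / 2 : ℕ) : ZMod m)

/-- The defining relations of `B̂_G(Υ)`: those of `B_G(Υ)` (Definition 5.1), with
relation (6) replaced by (6'), written out for the dihedral group of type `I₂(m)`,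
`m = 2n` (the reflection `sᵢ` in the line `H_i` is `sr i`; for `i ≠ j` two distinct lines
`H_i, H_j`, the set `{k : H_k ⊇ H_i ∩ H_j}` is the set of all lines, so relation (4)
never applies, `R(i,j) = {sr c : 2c = i + j}` when `i − j` is even, and `R(i,j) = ∅`
when `i − j` is odd). -/
inductive BRel (μ τ : ZMod m → ℂ) :
    FreeAlgebra ℂ (Gen m) → FreeAlgebra ℂ (Gen m) → Prop
  | grp_one : BRel μ τ (gW m 1) 1
  | grp_mul (w₁ w₂ : DihedralGroup m) :
      BRel μ τ (gW m w₁ * gW m w₂) (gW m (w₁ * w₂))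
  | se (i : ZMod m) : BRel μ τ (gW m (sr i) * gE m i) (gE m i)
  | es (i : ZMod m) : BRel μ τ (gE m i * gW m (sr i)) (gE m i)
  | e_sq (i : ZMod m) : BRel μ τ (gE m i * gE m i) (τ i • gE m i)
  | move (w : DihedralGroup m) (i : ZMod m) :
      BRel μ τ (gW m w * gE m i) (gE m (conjIdx m w i) * gW m w)
  | e_even (i j c : ZMod m) (hij : i ≠ j) (hpar : i.val % 2 = j.val % 2)
      (hc : c + c = i + j) :
      BRel μ τ (gE m i * gE m j)
        ((μ c • gW m (sr c) + μ (c + nZ m) • gW m (sr (c + nZ m))) * gE m j)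
  | e_comm' (i j : ZMod m) (h : i.val % 2 ≠ j.val % 2) :
      BRel μ τ (gE m i * gE m j) (gE m j * gE m i)

/-- The algebra `B̂_G(Υ)` for `G` the dihedral group of type `I₂(m)`, `m = 2n`. -/
def BHat (μ τ : ZMod m → ℂ) := RingQuot (BRel m μ τ)

instance (μ τ : ZMod m → ℂ) : Ring (BHat m μ τ) :=
  inferInstanceAs (Ring (RingQuot (BRel m μ τ)))
instance (μ τ : ZMod m → ℂ) : Algebra ℂ (BHat m μ τ) :=
  inferInstanceAs (Algebra ℂ (RingQuot (BRel m μ τ)))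

/-- The element `w̄ ∈ B̂_G(Υ)`. -/
def wbar (μ τ : ZMod m → ℂ) (w : DihedralGroup m) : BHat m μ τ :=
  RingQuot.mkAlgHom ℂ (BRel m μ τ) (gW m w)

/-- The generator `e_i ∈ B̂_G(Υ)`. -/
def ebar (μ τ : ZMod m → ℂ) (i : ZMod m) : BHat m μ τ :=
  RingQuot.mkAlgHom ℂ (BRel m μ τ) (gE m i)

end DihHat

namespace DihHat
open DihedralGroup

section rels
variable {m : ℕ} (μ τ : ZMod m → ℂ)

lemma B_mul (w₁ w₂ : DihedralGroup m) :
    wbar m μ τ w₁ * wbar m μ τ w₂ = wbar m μ τ (w₁ * w₂) := by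
  have h := RingQuot.mkAlgHom_rel ℂ (BRel.grp_mul (μ := μ) (τ := τ) w₁ w₂)
  rw [map_mul] at h; exact h

lemma B_one : wbar m μ τ 1 = 1 := by
  have h := RingQuot.mkAlgHom_rel ℂ (BRel.grp_one (μ := μ) (τ := τ))
  rw [map_one] at h; exact h

lemma B_se (i : ZMod m) : wbar m μ τ (sr i) * ebar m μ τ i = ebar m μ τ i := by
  have h := RingQuot.mkAlgHom_rel ℂ (BRel.se (μ := μ) (τ := τ) i)
  rw [map_mul] at h; exact h

lemma B_sq (i : ZMod m) : ebar m μ τ i * ebar m μ τ i = τ i • ebar m μ τ i := by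
  have h := RingQuot.mkAlgHom_rel ℂ (BRel.e_sq (μ := μ) (τ := τ) i)
  rw [map_mul, map_smul] at h; exact h

lemma B_move (w : DihedralGroup m) (i : ZMod m) :
    wbar m μ τ w * ebar m μ τ i = ebar m μ τ (conjIdx m w i) * wbar m μ τ w := by
  have h := RingQuot.mkAlgHom_rel ℂ (BRel.move (μ := μ) (τ := τ) w i)
  rw [map_mul, map_mul] at h; exact h

lemma B_even (i j c : ZMod m) (hij : i ≠ j) (hpar : i.val % 2 = j.val % 2)
    (hc : c + c = i + j) : ebar m μ τ i * ebar m μ τ j =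
      (μ c • wbar m μ τ (sr c) + μ (c + nZ m) • wbar m μ τ (sr (c + nZ m))) * ebar m μ τ j := by
  have h := RingQuot.mkAlgHom_rel ℂ (BRel.e_even (μ := μ) (τ := τ) i j c hij hpar hc)
  rw [map_mul, map_mul, map_add, map_smul, map_smul] at h; exact h

lemma B_comm (i j : ZMod m) (hh : i.val % 2 ≠ j.val % 2) :
    ebar m μ τ i * ebar m μ τ j = ebar m μ τ j * ebar m μ τ i := by
  have h := RingQuot.mkAlgHom_rel ℂ (BRel.e_comm' (μ := μ) (τ := τ) i j hh)
  rw [map_mul, map_mul] at h; exact h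

lemma conj_sr (c j : ZMod m) : conjIdx m (sr c) j = c + c - j := by
  simp [conjIdx]; ring

lemma conj_r (c j : ZMod m) : conjIdx m (r c) j = j - c - c := by
  simp [conjIdx]; ring

end rels

lemma par_add (nn : ℕ) (hn : 2 ≤ nn) (a b : ZMod (2 * nn)) :
    (a + b).val % 2 = (a.val + b.val) % 2 := by
  haveI : NeZero (2 * nn) := ⟨by omega⟩
  rw [ZMod.val_add, Nat.mod_mod_of_dvd _ (dvd_mul_right 2 nn)]

lemma NN (nn : ℕ) : nZ (2 * nn) + nZ (2 * nn) = 0 := by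
  have h : 2 * nn / 2 = nn := by omega
  rw [nZ, h, ← Nat.cast_add, ← two_mul, ZMod.natCast_self]

lemma valN (nn : ℕ) (hn : 2 ≤ nn) : (nZ (2 * nn)).val = nn := by
  have h : 2 * nn / 2 = nn := by omega
  rw [nZ, h, ZMod.val_cast_of_lt (by omega)]

lemma half (nn : ℕ) (hn : 2 ≤ nn) (x : ZMod (2 * nn)) (hx : x + x = 0) :
    x = 0 ∨ x = nZ (2 * nn) := by
  haveI : NeZero (2 * nn) := ⟨by omega⟩
  have h2 : (((x.val + x.val : ℕ)) : ZMod (2 * nn)) = 0 := by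
    simpa using hx
  rw [ZMod.natCast_eq_zero_iff] at h2
  have hlt := x.val_lt
  obtain ⟨q, hq⟩ := h2
  have hq2 : q < 2 := by nlinarith
  interval_cases q
  · left; rw [← ZMod.val_eq_zero]; omega
  · right; apply ZMod.val_injective; rw [valN nn hn]; omega

lemma exists_c (nn : ℕ) (hn : 2 ≤ nn) (i j : ZMod (2 * nn)) (h : i.val % 2 = j.val % 2) :
    ∃ c : ZMod (2 * nn), c + c = i + j := by
  haveI : NeZero (2 * nn) := ⟨by omega⟩
  refine ⟨(((i.val + j.val) / 2 : ℕ) : ZMod (2 * nn)), ?_⟩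
  rw [← Nat.cast_add]
  have : (i.val + j.val) / 2 + (i.val + j.val) / 2 = i.val + j.val := by omega
  rw [this]; simp

section main
variable {nn : ℕ} (hn : 2 ≤ nn) (μ τ : ZMod (2 * nn) → ℂ)

local notation "E" => ebar (2 * nn) μ τ
local notation "S" => wbar (2 * nn) μ τ
local notation "N" => nZ (2 * nn)

lemma sN (i : ZMod (2 * nn)) : S (sr (i + N)) = S (r N) * S (sr i) := by
  rw [B_mul, r_mul_sr]
  congr 2
  linear_combination NN nn

lemma z_sq : S (r N) * S (r N) = 1 := by
  rw [B_mul, r_mul_r, NN, ← one_def, B_one]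

lemma z_e (i : ZMod (2 * nn)) : S (r N) * E i = E i * S (r N) := by
  rw [B_move, conj_r]
  congr 2
  linear_combination - NN nn

lemma s_e (c i k : ZMod (2 * nn)) (h : k = c + c - i) : S (sr c) * E i = E k * S (sr c) := by
  rw [B_move, conj_sr, h]

include hn in
lemma key (i j k : ZMod (2 * nn)) (hij : i.val % 2 ≠ j.val % 2) (hk : k = i + i - j)
    (hkj : k ≠ j) :
    (μ i - τ k) • (E i * E j) + μ (i + N) • (S (r N) * (E i * E j)) = 0 := by
  have hpar : k.val % 2 = j.val % 2 := by
    have h1 : k + j = i + i := by rw [hk]; ring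
    have h2 := par_add nn hn k j
    have h3 := par_add nn hn i i
    rw [h1] at h2
    omega
  have hc := B_comm μ τ i j hij
  have hs : S (sr i) * (E i * E j) = E i * E j := by rw [← mul_assoc, B_se]
  have h1 : E i * E j = E k * E i := by
    calc E i * E j = S (sr i) * (E i * E j) := hs.symm
      _ = E k * E i := by rw [hc, ← mul_assoc, s_e μ τ i j k hk, mul_assoc, B_se]
  have h2 : E k * (E i * E j) = τ k • (E i * E j) := by
    rw [h1, ← mul_assoc, B_sq, smul_mul_assoc]
  have h3 : E k * (E i * E j) = μ i • (E i * E j) + μ (i + N) • (S (r N) * (E i * E j)) := by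
    conv_lhs => rw [hc, ← mul_assoc, B_even μ τ k j i hkj hpar (by rw [hk]; ring), mul_assoc, ← hc]
    rw [add_mul, smul_mul_assoc, smul_mul_assoc, sN, mul_assoc, hs]
  rw [sub_smul, ← h2, h3]; abel

include hn in
lemma part1 (i j k : ZMod (2 * nn)) (hij : i.val % 2 ≠ j.val % 2) (hk : k = i + i - j)
    (hkj : k ≠ j) (ha : μ i + μ (i + N) - τ k ≠ 0) (hb : μ i - μ (i + N) - τ k ≠ 0) :
    E i * E j = 0 := by
  have h := key hn μ τ i j k hij hk hkj
  generalize hP : E i * E j = P at h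
  have h' := congrArg (fun x => S (r N) * x) h
  simp only [mul_add, mul_smul_comm, mul_zero] at h'
  rw [← mul_assoc, z_sq, one_mul] at h'
  have h4 : ((μ i + μ (i + N) - τ k) * (μ i - μ (i + N) - τ k)) • P = 0 := by
    have : ((μ i + μ (i + N) - τ k) * (μ i - μ (i + N) - τ k)) • P =
      (μ i - τ k) • ((μ i - τ k) • P + μ (i + N) • (S (r N) * P))
      - μ (i + N) • ((μ i - τ k) • (S (r N) * P) + μ (i + N) • P) := by module
    rw [this, h, h']; simp
  exact (smul_eq_zero.mp h4).resolve_left (mul_ne_zero ha hb)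

include hn in
lemma part2 (hμ : ∀ a b : ZMod (2 * nn), a.val % 2 = b.val % 2 → μ a = μ b)
    (hτ : ∀ a b : ZMod (2 * nn), a.val % 2 = b.val % 2 → τ a = τ b)
    (hodd : nn % 2 = 1) (i : ZMod (2 * nn)) (hi : i.val % 2 = 0)
    (ha : μ 1 + μ 0 ≠ 0) (hb : μ 0 + μ 1 - τ 0 ≠ 0) :
    E i * E (i + N) = 0 := by
  have v0 : (0 : ZMod (2 * nn)).val = 0 := ZMod.val_zero
  have v1 : (1 : ZMod (2 * nn)).val = 1 := by
    have := ZMod.val_cast_of_lt (n := 2 * nn) (a := 1) (by omega)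
    simpa using this
  have v2 : (2 : ZMod (2 * nn)).val = 2 := by
    have := ZMod.val_cast_of_lt (n := 2 * nn) (a := 2) (by omega)
    simpa using this
  have v4 : (4 : ZMod (2 * nn)).val = 4 := by
    have := ZMod.val_cast_of_lt (n := 2 * nn) (a := 4) (by omega)
    simpa using this
  have vN := valN nn hn
  have hij : i.val % 2 ≠ (i + N).val % 2 := by
    have := par_add nn hn i N; omega
  have hc := B_comm μ τ i (i + N) hij
  have hs : S (sr i) * (E i * E (i + N)) = E i * E (i + N) := by rw [← mul_assoc, B_se]
  have hs' : S (sr (i + N)) * (E i * E (i + N)) = E i * E (i + N) := by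
    rw [hc, ← mul_assoc, B_se]
  have hz : S (r N) * (E i * E (i + N)) = E i * E (i + N) := by
    rw [sN, mul_assoc, hs] at hs'; exact hs'
  have p2 := par_add nn hn i 2
  have p1 := par_add nn hn i 1
  have pN := par_add nn hn i N
  have pNN := par_add nn hn (i + N) N
  have p1N := par_add nn hn (i + 1) N
  have pm : (i - 2).val % 2 = 0 := by
    have := par_add nn hn (i - 2) 2
    rw [sub_add_cancel] at this; omega
  -- Q = e_{i+N} e_{i+2}
  have hQ := key hn μ τ (i + N) (i + 2) (i - 2) (by omega) (by linear_combination - NN nn) (by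
    intro h
    have h4 : (4 : ZMod (2 * nn)) = 0 := by linear_combination - h
    rw [h4] at v4; omega)
  rw [hμ (i + N) 1 (by omega), hμ (i + N + N) 0 (by omega), hτ (i - 2) 0 (by omega),
    B_comm μ τ (i + N) (i + 2) (by omega)] at hQ
  have hQ' := congrArg (fun x => x * E i) hQ
  simp only [add_mul, smul_mul_assoc, zero_mul] at hQ'
  have e1 : E (i + 2) * E (i + N) * E i = E (i + 2) * (E i * E (i + N)) := by
    rw [mul_assoc, hc]
  have e2 : S (r N) * (E (i + 2) * E (i + N)) * E i = E (i + 2) * (E i * E (i + N)) := by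
    rw [mul_assoc, e1, ← mul_assoc, z_e, mul_assoc, hz]
  rw [e1, e2, ← add_smul] at hQ'
  have hkP : E (i + 2) * (E i * E (i + N)) = 0 :=
    (smul_eq_zero.mp hQ').resolve_left (by intro h; apply hb; linear_combination h)
  rw [← mul_assoc, B_even μ τ (i + 2) i (i + 1) (by
    intro h
    have h4 : (2 : ZMod (2 * nn)) = 0 := by linear_combination h
    rw [h4] at v2; omega) (by omega) (by ring), mul_assoc, add_mul, smul_mul_assoc, smul_mul_assoc,
    hμ (i + 1) 1 (by omega), hμ (i + 1 + N) 0 (by omega)] at hkP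
  have e3 : S (sr (i + 1 + N)) * (E i * E (i + N)) = S (sr (i + 1)) * (E i * E (i + N)) := by
    have : S (sr (i + 1 + N)) = S (sr (i + 1)) * S (r N) := by rw [B_mul, sr_mul_r]
    rw [this, mul_assoc, hz]
  rw [e3, ← add_smul] at hkP
  have hfin := (smul_eq_zero.mp hkP).resolve_left ha
  have := congrArg (fun x => S (sr (i + 1)) * x) hfin
  simp only [mul_zero] at this
  rw [← mul_assoc, B_mul, sr_mul_self, B_one, one_mul] at this
  exact this

end main
end DihHat

open DihHat DihedralGroup in
/-- in the algebra `B̂_G(Υ)` attached to the dihedral group of type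
`I₂(2n)`, under the stated genericity conditions on the parameters, for every
finite-dimensional irreducible representation `ρ` one has `ρ(e_i)ρ(e_j) = ρ(e_j)ρ(e_i) = 0`
for the relevant pairs of reflection lines with `R(i,j) = ∅`. -/
theorem dihedral_hat_e_products_vanish (nn : ℕ) (hn : 2 ≤ nn)
    (μ τ : ZMod (2 * nn) → ℂ)
    (hμ : ∀ a b : ZMod (2 * nn), a.val % 2 = b.val % 2 → μ a = μ b)
    (hτ : ∀ a b : ZMod (2 * nn), a.val % 2 = b.val % 2 → τ a = τ b) :
    -- statement (1)
    (∀ i j : ZMod (2 * nn),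
      (∀ c : ZMod (2 * nn), conjIdx (2 * nn) (sr c) j ≠ i) →
      sr i * sr j ≠ sr j * sr i →
      μ i + μ (nZ (2 * nn) + i) - τ (conjIdx (2 * nn) (sr i) j) ≠ 0 →
      μ i - μ (nZ (2 * nn) + i) - τ (conjIdx (2 * nn) (sr i) j) ≠ 0 →
      ∀ (W : Type) (_ : AddCommGroup W), ∀ (_ : Module ℂ W),
        ∀ (_ : FiniteDimensional ℂ W) (_ : Nontrivial W),
        ∀ ρ : BHat (2 * nn) μ τ →ₐ[ℂ] Module.End ℂ W,
        (∀ U : Submodule ℂ W, (∀ (a : BHat (2 * nn) μ τ) (x : W), x ∈ U → ρ a x ∈ U) →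
          U = ⊥ ∨ U = ⊤) →
        ρ (ebar (2 * nn) μ τ i) * ρ (ebar (2 * nn) μ τ j) = 0 ∧
        ρ (ebar (2 * nn) μ τ j) * ρ (ebar (2 * nn) μ τ i) = 0) ∧
    -- statement (2)
    (∀ i j : ZMod (2 * nn),
      (∀ c : ZMod (2 * nn), conjIdx (2 * nn) (sr c) j ≠ i) →
      sr i * sr j = sr j * sr i →
      τ 0 * (μ 1 + μ 0) ≠ 0 →
      τ 0 * (μ 1 - μ 0) ≠ 0 →
      μ 2 + μ (nZ (2 * nn) + 2) - τ 4 ≠ 0 →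
      μ 2 - μ (nZ (2 * nn) + 2) - τ 4 ≠ 0 →
      ∀ (W : Type) (_ : AddCommGroup W), ∀ (_ : Module ℂ W),
        ∀ (_ : FiniteDimensional ℂ W) (_ : Nontrivial W),
        ∀ ρ : BHat (2 * nn) μ τ →ₐ[ℂ] Module.End ℂ W,
        (∀ U : Submodule ℂ W, (∀ (a : BHat (2 * nn) μ τ) (x : W), x ∈ U → ρ a x ∈ U) →
          U = ⊥ ∨ U = ⊤) →
        ρ (ebar (2 * nn) μ τ i) * ρ (ebar (2 * nn) μ τ j) = 0 ∧
        ρ (ebar (2 * nn) μ τ j) * ρ (ebar (2 * nn) μ τ i) = 0) := by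
  have hpar : ∀ i j : ZMod (2 * nn), (∀ c : ZMod (2 * nn), conjIdx (2 * nn) (sr c) j ≠ i) →
      i.val % 2 ≠ j.val % 2 := by
    intro i j h hp
    obtain ⟨c, hc⟩ := exists_c nn hn i j hp
    apply h c
    rw [conj_sr, hc]; ring
  constructor
  · intro i j hR hcomm h1 h2 W _ _ _ _ ρ _
    have hp := hpar i j hR
    rw [conj_sr, add_comm (nZ (2 * nn)) i] at h1 h2
    have hP := part1 hn μ τ i j _ hp rfl (by
      intro h
      apply hcomm
      rw [sr_mul_sr, sr_mul_sr]
      congr 1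
      linear_combination - h) h1 h2
    have hP' := hP
    rw [B_comm μ τ i j hp] at hP'
    rw [← map_mul, ← map_mul, hP, hP', map_zero]
    exact ⟨rfl, rfl⟩
  · intro i j hR hcomm h1 _ h3 _ W _ _ _ _ ρ _
    have hp := hpar i j hR
    have hd : j - i + (j - i) = 0 := by
      rw [sr_mul_sr, sr_mul_sr] at hcomm
      have := DihedralGroup.r.inj hcomm
      linear_combination this
    have hj : j = i + nZ (2 * nn) := by
      rcases half nn hn _ hd with h | h
      · exact absurd (by rw [sub_eq_zero.mp h]) hp
      · linear_combination h
    have hi : i = j + nZ (2 * nn) := by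
      rw [hj]; linear_combination - NN nn
    have vN := valN nn hn
    have pj := par_add nn hn i (nZ (2 * nn))
    rw [← hj] at pj
    have hodd : nn % 2 = 1 := by omega
    have v0 : (0 : ZMod (2 * nn)).val = 0 := ZMod.val_zero
    have v1 : (1 : ZMod (2 * nn)).val = 1 := by
      have := ZMod.val_cast_of_lt (n := 2 * nn) (a := 1) (by omega)
      simpa using this
    have v2 : (2 : ZMod (2 * nn)).val = 2 := by
      have := ZMod.val_cast_of_lt (n := 2 * nn) (a := 2) (by omega)
      simpa using this
    have v4 : (4 : ZMod (2 * nn)).val = 4 := by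
      have := ZMod.val_cast_of_lt (n := 2 * nn) (a := 4) (by omega)
      simpa using this
    have pN2 := par_add nn hn (nZ (2 * nn)) 2
    rw [hμ 2 0 (by omega), hμ (nZ (2 * nn) + 2) 1 (by omega), hτ 4 0 (by omega)] at h3
    have ha := right_ne_zero_of_mul h1
    have hcm := B_comm μ τ i j hp
    have hP : ebar (2 * nn) μ τ i * ebar (2 * nn) μ τ j = 0 := by
      rcases Nat.mod_two_eq_zero_or_one i.val with h0 | h0
      · have := part2 hn μ τ hμ hτ hodd i h0 ha h3
        rwa [← hj] at this
      · have := part2 hn μ τ hμ hτ hodd j (by omega) ha h3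
        rw [← hi] at this
        rw [hcm, this]
    have hP' := hP
    rw [hcm] at hP'
    rw [← map_mul, ← map_mul, hP, hP', map_zero]
    exact ⟨rfl, rfl⟩
end
end
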